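/- arXiv:1912.07713 — 2 statements merged into one kernel-verified Lean document; each statement's English description precedes it below -/
import Mathlib

section
/- In the class X, if θ and τ are Wilf-equivalent permutations of X neither of which ends with its maximum, then 1 ⊕ θ and 1 ⊕ τ are Wilf-equivalent in X. -/
open Equiv Filter

/-- A permutation pattern: a size together with a permutation of that size. -/
abbrev Pattern := Σ n : ℕ, Equiv.Perm (Fin n)

/-- Direct sum of permutations: `α` to the left of and below `β`. -/
def sumPerm {m n : ℕ} (α : Equiv.Perm (Fin m)) (β : Equiv.Perm (Fin n)) :
    Equiv.Perm (Fin (m + n)) :=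
  finSumFinEquiv.symm.trans ((α.sumCongr β).trans finSumFinEquiv)

/-- Skew sum of permutations: `α` to the left of and above `β`. -/
def skewPerm {m n : ℕ} (α : Equiv.Perm (Fin m)) (β : Equiv.Perm (Fin n)) :
    Equiv.Perm (Fin (m + n)) :=
  finSumFinEquiv.symm.trans ((α.sumCongr β).trans
    ((Equiv.sumComm (Fin m) (Fin n)).trans (finSumFinEquiv.trans (finCongr (Nat.add_comm n m)))))

/-- Pattern containment: `Contains p q` means `p` is contained (as a pattern) in `q`. -/
def Contains (p q : Pattern) : Prop :=
  ∃ f : Fin p.1 → Fin q.1, StrictMono f ∧ ∀ s t, p.2 s < p.2 t ↔ q.2 (f s) < q.2 (f t)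

def sumP (p q : Pattern) : Pattern := ⟨p.1 + q.1, sumPerm p.2 q.2⟩
def skewP (p q : Pattern) : Pattern := ⟨p.1 + q.1, skewPerm p.2 q.2⟩

/-- The singleton permutation 1. -/
def onePat : Pattern := ⟨1, 1⟩
/-- The increasing permutation of size `k`. -/
def idPat (k : ℕ) : Pattern := ⟨k, 1⟩
/-- The decreasing permutation of size `k`. -/
def revPat (k : ℕ) : Pattern := ⟨k, Fin.revPerm⟩

def BeginsWithMin (p : Pattern) : Prop := ∃ h : 0 < p.1, p.2 ⟨0, h⟩ = ⟨0, h⟩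
def EndsWithMax (p : Pattern) : Prop :=
  ∃ h : 0 < p.1, p.2 ⟨p.1 - 1, by omega⟩ = ⟨p.1 - 1, by omega⟩
def BeginsWithMax (p : Pattern) : Prop :=
  ∃ h : 0 < p.1, p.2 ⟨0, h⟩ = ⟨p.1 - 1, by omega⟩
def EndsWithMin (p : Pattern) : Prop :=
  ∃ h : 0 < p.1, p.2 ⟨p.1 - 1, by omega⟩ = ⟨0, h⟩

def IsIncreasingP (p : Pattern) : Prop := ∀ i j : Fin p.1, i ≤ j → p.2 i ≤ p.2 j
def IsDecreasingP (p : Pattern) : Prop := ∀ i j : Fin p.1, i ≤ j → p.2 j ≤ p.2 i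
/-- Monotone permutations (increasing or decreasing). -/
def MonotoneP (p : Pattern) : Prop := IsIncreasingP p ∨ IsDecreasingP p
/-- A crossed permutation is one that is not monotone. -/
def CrossedP (p : Pattern) : Prop := ¬ MonotoneP p
/-- Positive: size at least 2, begins with its minimum or ends with its maximum. -/
def PositiveP (p : Pattern) : Prop := 2 ≤ p.1 ∧ (BeginsWithMin p ∨ EndsWithMax p)
/-- Negative: size at least 2, begins with its maximum or ends with its minimum. -/
def NegativeP (p : Pattern) : Prop := 2 ≤ p.1 ∧ (BeginsWithMax p ∨ EndsWithMin p)

/-- The class X: the closure of {1} under π ↦ 1⊕π, 1⊖π, π⊕1, π⊖1. -/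
inductive InX : Pattern → Prop
  | base : InX onePat
  | sumL {p : Pattern} : InX p → InX (sumP onePat p)
  | skewL {p : Pattern} : InX p → InX (skewP onePat p)
  | sumR {p : Pattern} : InX p → InX (sumP p onePat)
  | skewR {p : Pattern} : InX p → InX (skewP p onePat)

/-- The number of permutations of size n in X avoiding the pattern p. -/
noncomputable def avXCount (p : Pattern) (n : ℕ) : ℕ :=
  Nat.card {σ : Equiv.Perm (Fin n) // InX ⟨n, σ⟩ ∧ ¬ Contains p ⟨n, σ⟩}

/-- Wilf equivalence in the class X. -/
def WilfEquivX (p q : Pattern) : Prop := ∀ n : ℕ, avXCount p n = avXCount q n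


namespace OneSum

/-- One-line notation of a pattern as a function on naturals. -/
def pv (p : Pattern) (i : ℕ) : ℕ := if h : i < p.1 then (p.2 ⟨i, h⟩ : ℕ) else i

lemma pv_lt (p : Pattern) {i : ℕ} (h : i < p.1) : pv p i < p.1 := by
  simp [pv, h]

lemma pv_inj (p : Pattern) {i j : ℕ} (hi : i < p.1) (hj : j < p.1) (h : pv p i = pv p j) :
    i = j := by
  simp only [pv, hi, hj, dif_pos] at h
  have := p.2.injective (Fin.ext h)
  simpa using this

lemma pv_surj (p : Pattern) {k : ℕ} (hk : k < p.1) : ∃ i, i < p.1 ∧ pv p i = k := by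
  obtain ⟨i, hi⟩ := p.2.surjective ⟨k, hk⟩
  exact ⟨i, i.2, by simp [pv, hi]⟩

lemma pat_ext {p q : Pattern} (h1 : p.1 = q.1) (h2 : ∀ i, i < p.1 → pv p i = pv q i) : p = q := by
  obtain ⟨n, s⟩ := p
  obtain ⟨m, t⟩ := q
  dsimp only at h1
  subst h1
  congr 1
  ext i
  have := h2 i i.2
  simpa [pv] using this

lemma pat_mk (n : ℕ) (f : ℕ → ℕ) (hf : ∀ i, i < n → f i < n)
    (hinj : ∀ i j, i < n → j < n → f i = f j → i = j) :
    ∃ p : Pattern, p.1 = n ∧ ∀ i, i < n → pv p i = f i := by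
  let g : Fin n → Fin n := fun i => ⟨f i, hf i i.2⟩
  have hg : Function.Injective g := by
    intro i j hij
    have : f i = f j := by simpa [g] using hij
    exact Fin.ext (hinj _ _ i.2 j.2 this)
  refine ⟨⟨n, Equiv.ofBijective g (Finite.injective_iff_bijective.mp hg)⟩, rfl, ?_⟩
  intro i hi
  simp [pv, hi, g]

/-- The four ways of adding an extremal point. -/
inductive Op
  | sl | sr | kl | kr

/-- The operation named by a code. -/
def op : Op → Pattern → Pattern
  | .sl, p => sumP onePat p
  | .sr, p => sumP p onePat
  | .kl, p => skewP onePat p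
  | .kr, p => skewP p onePat

/-- The opposite code. -/
def opp : Op → Op
  | .sl => .sr
  | .sr => .sl
  | .kl => .kr
  | .kr => .kl

lemma op_size (a : Op) (p : Pattern) : (op a p).1 = p.1 + 1 := by
  cases a <;> simp [op, sumP, skewP, onePat, Nat.add_comm]

lemma perm_one_zero (x : Fin 1) : (x : ℕ) = 0 := by omega

lemma finSum_symm_lt {m n : ℕ} (i : ℕ) (h : i < m + n) (hi : i < m) :
    (finSumFinEquiv (m := m) (n := n)).symm ⟨i, h⟩ = Sum.inl ⟨i, hi⟩ := by
  rw [Equiv.symm_apply_eq]; rfl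

lemma finSum_symm_ge {m n : ℕ} (i : ℕ) (h : i < m + n) (hi : m ≤ i) :
    (finSumFinEquiv (m := m) (n := n)).symm ⟨i, h⟩ = Sum.inr ⟨i - m, by omega⟩ := by
  rw [Equiv.symm_apply_eq]
  ext
  simp
  omega

lemma sumPerm_val {m n : ℕ} (α : Equiv.Perm (Fin m)) (β : Equiv.Perm (Fin n)) (x : Fin (m + n)) :
    sumPerm α β x = finSumFinEquiv (Sum.map α β (finSumFinEquiv.symm x)) := rfl

lemma skewPerm_val {m n : ℕ} (α : Equiv.Perm (Fin m)) (β : Equiv.Perm (Fin n)) (x : Fin (m + n)) :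
    (skewPerm α β x : ℕ) =
      (finSumFinEquiv (Sum.swap (Sum.map α β (finSumFinEquiv.symm x))) : ℕ) := rfl

lemma pv_sum (p q : Pattern) (i : ℕ) (hi : i < p.1 + q.1) :
    pv (sumP p q) i = if i < p.1 then pv p i else p.1 + pv q (i - p.1) := by
  split_ifs with h
  · have e : pv (sumP p q) i = (sumPerm p.2 q.2 ⟨i, hi⟩ : ℕ) := dif_pos hi
    rw [e, sumPerm_val, finSum_symm_lt i hi h]
    simp [pv, h]
  · have h2 : i - p.1 < q.1 := by omega
    have e : pv (sumP p q) i = (sumPerm p.2 q.2 ⟨i, hi⟩ : ℕ) := dif_pos hi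
    rw [e, sumPerm_val, finSum_symm_ge i hi (by omega)]
    simp [pv, h2]

lemma pv_skew (p q : Pattern) (i : ℕ) (hi : i < p.1 + q.1) :
    pv (skewP p q) i = if i < p.1 then q.1 + pv p i else pv q (i - p.1) := by
  split_ifs with h
  · have e : pv (skewP p q) i = (skewPerm p.2 q.2 ⟨i, hi⟩ : ℕ) := dif_pos hi
    rw [e, skewPerm_val, finSum_symm_lt i hi h]
    simp [pv, h]
  · have h2 : i - p.1 < q.1 := by omega
    have e : pv (skewP p q) i = (skewPerm p.2 q.2 ⟨i, hi⟩ : ℕ) := dif_pos hi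
    rw [e, skewPerm_val, finSum_symm_ge i hi (by omega)]
    simp [pv, h2]

lemma one_size : onePat.1 = 1 := rfl
lemma pv_one : pv onePat 0 = 0 := by simp [pv, onePat]

lemma pv_sl (p : Pattern) (i : ℕ) (hi : i < p.1 + 1) :
    pv (op .sl p) i = if i = 0 then 0 else pv p (i - 1) + 1 := by
  rw [op, pv_sum _ _ _ (by rw [one_size]; omega), one_size]
  split_ifs <;> try omega
  · subst i; exact pv_one

lemma pv_sr (p : Pattern) (i : ℕ) (hi : i < p.1 + 1) :
    pv (op .sr p) i = if i = p.1 then p.1 else pv p i := by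
  rw [op, pv_sum _ _ _ (by rw [one_size]; omega)]
  split_ifs <;> try omega
  · subst i; simp [pv_one]

lemma pv_kl (p : Pattern) (i : ℕ) (hi : i < p.1 + 1) :
    pv (op .kl p) i = if i = 0 then p.1 else pv p (i - 1) := by
  rw [op, pv_skew _ _ _ (by rw [one_size]; omega), one_size]
  split_ifs <;> try omega
  · subst i; simp [pv_one]

lemma pv_kr (p : Pattern) (i : ℕ) (hi : i < p.1 + 1) :
    pv (op .kr p) i = if i = p.1 then 0 else pv p i + 1 := by
  rw [op, pv_skew _ _ _ (by rw [one_size]; omega), one_size]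
  split_ifs <;> try omega
  · subst i; simp [pv_one]

lemma op_inj (a : Op) {p q : Pattern} (h : op a p = op a q) : p = q := by
  have hs : p.1 = q.1 := by
    have := congrArg Sigma.fst h
    rw [op_size, op_size] at this
    omega
  refine pat_ext hs fun i hi => ?_
  cases a
  · have := congrArg (fun r => pv r (i + 1)) h
    simpa [pv_sl p (i+1) (by omega), pv_sl q (i+1) (by omega)] using this
  · have := congrArg (fun r => pv r i) h
    simp only [pv_sr p i (by omega), pv_sr q i (by omega)] at this
    rwa [if_neg (by omega), if_neg (by omega)] at this
  · have := congrArg (fun r => pv r (i + 1)) h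
    simpa [pv_kl p (i+1) (by omega), pv_kl q (i+1) (by omega)] using this
  · have := congrArg (fun r => pv r i) h
    simp only [pv_kr p i (by omega), pv_kr q i (by omega)] at this
    rw [if_neg (by omega), if_neg (by omega)] at this
    omega

lemma sum_comm (s : Pattern) : op .sl (op .sr s) = op .sr (op .sl s) := by
  refine pat_ext (by simp [op_size]) fun i hi => ?_
  simp only [op_size] at hi
  have e1 := pv_sl (op .sr s) i (by rw [op_size]; omega)
  have e2 := pv_sr (op .sl s) i (by rw [op_size]; omega)
  rw [e1, e2, op_size]
  by_cases h0 : i = 0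
  · subst h0
    simp [pv_sl s 0 (by omega)]
  · rw [pv_sr s (i-1) (by omega), if_neg h0]
    by_cases h1 : i = s.1 + 1
    · simp [h1]
    · rw [if_neg (by omega), if_neg h1, pv_sl s i (by omega), if_neg h0]

lemma skew_comm (s : Pattern) : op .kl (op .kr s) = op .kr (op .kl s) := by
  refine pat_ext (by simp [op_size]) fun i hi => ?_
  simp only [op_size] at hi
  have e1 := pv_kl (op .kr s) i (by rw [op_size]; omega)
  have e2 := pv_kr (op .kl s) i (by rw [op_size]; omega)
  rw [e1, e2, op_size, op_size]
  by_cases h0 : i = 0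
  · subst h0
    simp [pv_kl s 0 (by omega)]
  · rw [pv_kr s (i-1) (by omega), if_neg h0]
    by_cases h1 : i = s.1 + 1
    · simp [h1]
    · rw [if_neg (by omega), if_neg h1, pv_kl s i (by omega), if_neg h0]

lemma op_comm (a : Op) (s : Pattern) : op a (op (opp a) s) = op (opp a) (op a s) := by
  cases a
  · exact sum_comm s
  · exact (sum_comm s).symm
  · exact skew_comm s
  · exact (skew_comm s).symm

lemma exists_sr {p : Pattern} (h0 : 0 < p.1) (h : pv p (p.1 - 1) = p.1 - 1) :
    ∃ s, p = op .sr s := by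
  have key : ∀ i, i < p.1 - 1 → pv p i < p.1 - 1 := by
    intro i hi
    have h1 := pv_lt p (i := i) (by omega)
    by_contra hc
    have := pv_inj p (i := i) (j := p.1 - 1) (by omega) (by omega) (by omega)
    omega
  obtain ⟨s, hs, hv⟩ := pat_mk (p.1 - 1) (pv p) key
    (fun i j hi hj e => pv_inj p (by omega) (by omega) e)
  refine ⟨s, pat_ext (by rw [op_size]; omega) fun i hi => ?_⟩
  rw [pv_sr s i (by omega)]
  split_ifs with h1
  · rw [h1, hs, h]
  · rw [hv i (by omega)]

lemma exists_kr {p : Pattern} (h0 : 0 < p.1) (h : pv p (p.1 - 1) = 0) :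
    ∃ s, p = op .kr s := by
  have key : ∀ i, i < p.1 - 1 → 0 < pv p i := by
    intro i hi
    by_contra hc
    have := pv_inj p (i := i) (j := p.1 - 1) (by omega) (by omega) (by omega)
    omega
  obtain ⟨s, hs, hv⟩ := pat_mk (p.1 - 1) (fun i => pv p i - 1)
    (fun i hi => by have := pv_lt p (i := i) (by omega); have := key i hi; omega)
    (fun i j hi hj e => pv_inj p (by omega) (by omega)
      (by have := key i hi; have := key j hj; omega))
  refine ⟨s, pat_ext (by rw [op_size]; omega) fun i hi => ?_⟩
  rw [pv_kr s i (by omega)]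
  split_ifs with h1
  · rw [h1, hs, h]
  · rw [hv i (by omega)]
    have := key i (by omega)
    omega

lemma sum_split {p q : Pattern} (h : op .sl p = op .sr q) (hp : 0 < p.1) :
    ∃ s, p = op .sr s ∧ q = op .sl s := by
  have hs : p.1 = q.1 := by
    have := congrArg Sigma.fst h
    rw [op_size, op_size] at this
    omega
  obtain ⟨s, rfl⟩ : ∃ s, p = op .sr s := by
    apply exists_sr hp
    have := congrArg (fun r => pv r p.1) h
    simp only [pv_sl p p.1 (by omega), pv_sr q p.1 (by omega)] at this
    rw [if_neg (by omega), if_pos hs] at this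
    omega
  refine ⟨s, rfl, ?_⟩
  rw [sum_comm] at h
  exact (op_inj _ h).symm

lemma skew_split {p q : Pattern} (h : op .kl p = op .kr q) (hp : 0 < p.1) :
    ∃ s, p = op .kr s ∧ q = op .kl s := by
  have hs : p.1 = q.1 := by
    have := congrArg Sigma.fst h
    rw [op_size, op_size] at this
    omega
  obtain ⟨s, rfl⟩ : ∃ s, p = op .kr s := by
    apply exists_kr hp
    have := congrArg (fun r => pv r p.1) h
    simp only [pv_kl p p.1 (by omega), pv_kr q p.1 (by omega)] at this
    rw [if_neg (by omega), if_pos hs] at this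
    omega
  refine ⟨s, rfl, ?_⟩
  rw [skew_comm] at h
  exact (op_inj _ h).symm

/-- Codes of direct sum operations. -/
def isSum : Op → Prop
  | .sl => True
  | .sr => True
  | .kl => False
  | .kr => False

lemma sum_ne_skew {a b : Op} (ha : isSum a) (hb : ¬ isSum b) {p q : Pattern} (hp : 0 < p.1) :
    op a p ≠ op b q := by
  intro h
  have hs : p.1 = q.1 := by
    have := congrArg Sigma.fst h
    rw [op_size, op_size] at this
    omega
  have h1 := congrArg (fun r => pv r 0) h
  have h2 := congrArg (fun r => pv r p.1) h
  have b1 := pv_lt p hp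
  have b2 := pv_lt q (i := 0) (by omega)
  have b3 := pv_lt p (i := p.1 - 1) (by omega)
  have b4 := pv_lt q (i := p.1 - 1) (by omega)
  cases a <;> cases b <;> simp only [isSum, not_true_eq_false] at ha hb <;>
    simp only [pv_sl p _ (Nat.succ_pos _), pv_sr p _ (Nat.succ_pos _), pv_kl q _ (Nat.succ_pos _),
      pv_kr q _ (Nat.succ_pos _), pv_sl p p.1 (by omega), pv_sr p p.1 (by omega),
      pv_kl q p.1 (by omega), pv_kr q p.1 (by omega)] at h1 h2 <;> split_ifs at h1 h2 <;> omega

lemma op_eq {a b : Op} {p q : Pattern} (h : op a p = op b q) (hp : 0 < p.1) :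
    p = q ∧ a = b ∨ b = opp a ∧ ∃ s, p = op b s ∧ q = op a s := by
  have hs : p.1 = q.1 := by
    have := congrArg Sigma.fst h
    rw [op_size, op_size] at this
    omega
  by_cases hab : a = b
  · subst hab
    exact Or.inl ⟨op_inj a h, rfl⟩
  · right
    cases a <;> cases b <;> first
      | exact absurd rfl hab
      | (refine absurd h (sum_ne_skew ?_ ?_ hp) <;> first | exact trivial | exact not_false)
      | (refine absurd h.symm (sum_ne_skew ?_ ?_ (hs ▸ hp)) <;> first | exact trivial | exact not_false)
      | exact ⟨rfl, sum_split h hp⟩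
      | exact ⟨rfl, skew_split h hp⟩
      | (obtain ⟨s, h1, h2⟩ := sum_split h.symm (by omega); exact ⟨rfl, s, h2, h1⟩)
      | (obtain ⟨s, h1, h2⟩ := skew_split h.symm (by omega); exact ⟨rfl, s, h2, h1⟩)

/-- The class X together with the empty permutation. -/
def XE (p : Pattern) : Prop := p.1 = 0 ∨ InX p

lemma inX_op (a : Op) {p : Pattern} (h : InX p) : InX (op a p) := by
  cases a
  · exact h.sumL
  · exact h.sumR
  · exact h.skewL
  · exact h.skewR

lemma size_one {p q : Pattern} (hp : p.1 = 1) (hq : q.1 = 1) : p = q := by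
  refine pat_ext (by omega) fun i hi => ?_
  have := pv_lt p hi
  have := pv_lt q (i := i) (by omega)
  omega

lemma XE_op (a : Op) {p : Pattern} (h : XE p) : InX (op a p) := by
  rcases h with h | h
  · rw [size_one (p := op a p) (q := onePat) (by rw [op_size]; omega) rfl]
    exact InX.base
  · exact inX_op a h

lemma inX_cases {p : Pattern} (h : InX p) : p = onePat ∨ ∃ a q, InX q ∧ p = op a q := by
  cases h with
  | base => exact Or.inl rfl
  | sumL h => exact Or.inr ⟨.sl, _, h, rfl⟩
  | sumR h => exact Or.inr ⟨.sr, _, h, rfl⟩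
  | skewL h => exact Or.inr ⟨.kl, _, h, rfl⟩
  | skewR h => exact Or.inr ⟨.kr, _, h, rfl⟩

lemma XE_of_op : ∀ (n : ℕ) (a : Op) (p : Pattern), p.1 = n → InX (op a p) → XE p := by
  intro n
  induction n using Nat.strong_induction_on with
  | _ n ih =>
    intro a p hn h
    by_cases h0 : p.1 = 0
    · exact Or.inl h0
    rcases inX_cases h with h1 | ⟨b, q, hq, h1⟩
    · have := congrArg Sigma.fst h1
      rw [op_size, one_size] at this
      omega
    · rcases op_eq h1 (by omega) with ⟨rfl, -⟩ | ⟨-, s, rfl, rfl⟩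
      · exact Or.inr hq
      · have := ih s.1 (by rw [op_size] at hn; omega) a s rfl hq
        exact Or.inr (XE_op b this)

lemma XE_iff (a : Op) (p : Pattern) : XE (op a p) ↔ XE p := by
  constructor
  · rintro (h | h)
    · rw [op_size] at h; omega
    · exact XE_of_op _ a p rfl h
  · exact fun h => Or.inr (XE_op a h)

lemma XE_cases {p : Pattern} (h : XE p) (hp : 0 < p.1) : ∃ a q, XE q ∧ p = op a q := by
  rcases h with h | h
  · omega
  rcases inX_cases h with h1 | ⟨a, q, hq, h1⟩
  · obtain ⟨e, he, -⟩ := pat_mk 0 id (by simp) (by simp)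
    exact ⟨.sl, e, Or.inl he, size_one (by rw [h1]; rfl) (by rw [op_size, he])⟩
  · exact ⟨a, q, Or.inr hq, h1⟩

lemma contains_iff (p q : Pattern) : Contains p q ↔ ∃ f : ℕ → ℕ, (∀ i, i < p.1 → f i < q.1) ∧
    (∀ i j, i < j → j < p.1 → f i < f j) ∧
    ∀ i j, i < p.1 → j < p.1 → (pv p i < pv p j ↔ pv q (f i) < pv q (f j)) := by
  constructor
  · rintro ⟨f, hf, h⟩
    refine ⟨fun i => if hi : i < p.1 then f ⟨i, hi⟩ else 0, ?_, ?_, ?_⟩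
    · intro i hi
      simp [hi]
    · intro i j hij hj
      have hi : i < p.1 := by omega
      simp only [hi, hj, dif_pos]
      exact hf (by simpa using hij)
    · intro i j hi hj
      have := h ⟨i, hi⟩ ⟨j, hj⟩
      simpa [pv, hi, hj] using this
  · rintro ⟨f, h1, h2, h3⟩
    refine ⟨fun i => ⟨f i, h1 i i.2⟩, ?_, ?_⟩
    · intro i j hij
      exact h2 i j hij j.2
    · intro i j
      have := h3 i j i.2 j.2
      simpa [pv, h1 i i.2, h1 j j.2] using this

lemma contains_size {p q : Pattern} (h : Contains p q) : p.1 ≤ q.1 := by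
  obtain ⟨f, hf, -⟩ := h
  simpa using Fintype.card_le_of_injective f hf.injective

lemma contains_sl_sl (t p : Pattern) : Contains (op .sl t) (op .sl p) ↔ Contains t p := by
  rw [contains_iff, contains_iff]
  simp only [op_size]
  constructor
  · rintro ⟨f, h1, h2, h3⟩
    have pos : ∀ i, i < t.1 → 0 < f (i + 1) := fun i hi => by
      have := h2 0 (i + 1) (by omega) (by omega); omega
    refine ⟨fun i => f (i + 1) - 1, ?_, ?_, ?_⟩
    · intro i hi
      have := pos i hi; have := h1 (i+1) (by omega); dsimp only; omega
    · intro i j hij hj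
      have := pos i (by omega); have := h2 (i+1) (j+1) (by omega) (by omega); dsimp only; omega
    · intro i j hi hj
      have := h3 (i+1) (j+1) (by omega) (by omega)
      rw [pv_sl t _ (by omega), pv_sl t _ (by omega), pv_sl p _ (h1 _ (by omega)),
        pv_sl p _ (h1 _ (by omega)), if_neg (by omega), if_neg (by omega),
        if_neg (by have := pos i hi; omega), if_neg (by have := pos j hj; omega)] at this
      simpa using this
  · rintro ⟨f, h1, h2, h3⟩
    have b : ∀ i, i < t.1 + 1 → (if i = 0 then 0 else f (i - 1) + 1) < p.1 + 1 := by
      intro i hi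
      split_ifs
      · omega
      · have := h1 (i-1) (by omega); omega
    refine ⟨fun i => if i = 0 then 0 else f (i - 1) + 1, b, ?_, ?_⟩
    · intro i j hij hj
      have : i ≠ 0 → f (i-1) < f (j-1) := fun h => h2 (i-1) (j-1) (by omega) (by omega)
      dsimp only
      split_ifs <;> omega
    · intro i j hi hj
      dsimp only
      rw [pv_sl t _ (by omega), pv_sl t _ (by omega), pv_sl p _ (b i hi), pv_sl p _ (b j hj)]
      by_cases hi0 : i = 0 <;> by_cases hj0 : j = 0 <;> simp [hi0, hj0]
      exact h3 _ _ (by omega) (by omega)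

lemma contains_sr (t p : Pattern) (ht : 0 < t.1 → pv t (t.1 - 1) ≠ t.1 - 1) :
    Contains t (op .sr p) ↔ Contains t p := by
  rw [contains_iff, contains_iff]
  simp only [op_size]
  constructor
  · rintro ⟨f, h1, h2, h3⟩
    have key : ∀ i, i < t.1 → f i < p.1 := by
      intro i hi
      by_contra hc
      have hb := h1 i hi
      have hlast : i = t.1 - 1 := by
        by_contra hne
        have := h2 i (t.1 - 1) (by omega) (by omega)
        have := h1 (t.1 - 1) (by omega)
        omega
      apply ht (by omega)
      obtain ⟨j, hj, hjv⟩ := pv_surj t (k := t.1 - 1) (by omega)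
      by_cases hji : j = i
      · rw [← hlast, ← hji, hjv]; omega
      · have hlt := h2 j i (by omega) hi
        have := (h3 j i hj hi).mpr (by
          rw [pv_sr p _ (by omega), pv_sr p _ (by omega), if_neg (by omega), if_pos (by omega)]
          exact pv_lt p (by omega))
        have := pv_lt t hi
        omega
    refine ⟨f, key, h2, fun i j hi hj => ?_⟩
    have := key i hi
    have := key j hj
    rw [h3 i j hi hj, pv_sr p _ (by omega), pv_sr p _ (by omega), if_neg (by omega),
      if_neg (by omega)]
  · rintro ⟨f, h1, h2, h3⟩
    refine ⟨f, fun i hi => by have := h1 i hi; omega, h2, fun i j hi hj => ?_⟩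
    have := h1 i hi
    have := h1 j hj
    rw [h3 i j hi hj, pv_sr p _ (by omega), pv_sr p _ (by omega), if_neg (by omega),
      if_neg (by omega)]

lemma contains_kr (t p : Pattern) (ht : 0 < t.1 → pv t (t.1 - 1) ≠ 0) :
    Contains t (op .kr p) ↔ Contains t p := by
  rw [contains_iff, contains_iff]
  simp only [op_size]
  constructor
  · rintro ⟨f, h1, h2, h3⟩
    have key : ∀ i, i < t.1 → f i < p.1 := by
      intro i hi
      by_contra hc
      have hb := h1 i hi
      have hlast : i = t.1 - 1 := by
        by_contra hne
        have := h2 i (t.1 - 1) (by omega) (by omega)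
        have := h1 (t.1 - 1) (by omega)
        omega
      apply ht (by omega)
      obtain ⟨j, hj, hjv⟩ := pv_surj t (k := 0) (by omega)
      by_cases hji : j = i
      · rw [← hlast, ← hji, hjv]
      · have hlt := h2 j i (by omega) hi
        have := (h3 i j hi hj).mpr (by
          rw [pv_kr p _ (by omega), pv_kr p _ (by omega), if_pos (by omega), if_neg (by omega)]
          omega)
        omega
    refine ⟨f, key, h2, fun i j hi hj => ?_⟩
    have := key i hi
    have := key j hj
    rw [h3 i j hi hj, pv_kr p _ (by omega), pv_kr p _ (by omega), if_neg (by omega),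
      if_neg (by omega)]
    omega
  · rintro ⟨f, h1, h2, h3⟩
    refine ⟨f, fun i hi => by have := h1 i hi; omega, h2, fun i j hi hj => ?_⟩
    have := h1 i hi
    have := h1 j hj
    rw [h3 i j hi hj, pv_kr p _ (by omega), pv_kr p _ (by omega), if_neg (by omega),
      if_neg (by omega)]
    omega

lemma contains_kl (t p : Pattern) (ht : 0 < t.1 → pv t 0 ≠ t.1 - 1) :
    Contains t (op .kl p) ↔ Contains t p := by
  rw [contains_iff, contains_iff]
  simp only [op_size]
  constructor
  · rintro ⟨f, h1, h2, h3⟩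
    have key : ∀ i, i < t.1 → 0 < f i := by
      intro i hi
      by_contra hc
      have hb := h1 i hi
      have hlast : i = 0 := by
        by_contra hne
        have := h2 0 i (by omega) (by omega)
        omega
      apply ht (by omega)
      obtain ⟨j, hj, hjv⟩ := pv_surj t (k := t.1 - 1) (by omega)
      by_cases hji : j = i
      · rw [← hlast, ← hji, hjv]
      · have hlt := h2 i j (by omega) hj
        have hbj := h1 j hj
        have := (h3 j i hj hi).mpr (by
          rw [pv_kl p _ (by omega), pv_kl p _ (by omega), if_neg (by omega), if_pos (by omega)]
          exact pv_lt p (by omega))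
        have := pv_lt t hi
        omega
    refine ⟨fun i => f i - 1, fun i hi => ?_, fun i j hij hj => ?_, fun i j hi hj => ?_⟩
    · have := key i hi; have := h1 i hi; dsimp only; omega
    · have := key i (by omega); have := h2 i j hij hj; dsimp only; omega
    · have := key i hi
      have := key j hj
      rw [h3 i j hi hj, pv_kl p _ (h1 i hi), pv_kl p _ (h1 j hj), if_neg (by omega),
        if_neg (by omega)]
  · rintro ⟨f, h1, h2, h3⟩
    refine ⟨fun i => f i + 1, fun i hi => by have := h1 i hi; dsimp only; omega,
      fun i j hij hj => by have := h2 i j hij hj; dsimp only; omega, fun i j hi hj => ?_⟩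
    have := h1 i hi
    have := h1 j hj
    dsimp only
    rw [h3 i j hi hj, pv_kl p _ (by omega), pv_kl p _ (by omega), if_neg (by omega),
      if_neg (by omega)]
    simp

/-- Members of `XE` of size `n` avoiding `t`. -/
def S (t : Pattern) (n : ℕ) : Set Pattern := {p | p.1 = n ∧ XE p ∧ ¬ Contains t p}

lemma sized_eq (P : Pattern → Prop) (n : ℕ) :
    {p : Pattern | p.1 = n ∧ P p} = (Sigma.mk n) '' {s : Equiv.Perm (Fin n) | P ⟨n, s⟩} := by
  ext p
  constructor
  · rintro ⟨rfl, h⟩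
    exact ⟨p.2, h, rfl⟩
  · rintro ⟨s, hs, rfl⟩
    exact ⟨rfl, hs⟩

lemma S_finite (t : Pattern) (n : ℕ) : (S t n).Finite := by
  rw [S, sized_eq]
  exact (Set.toFinite _).image _

lemma S_card (t : Pattern) (n : ℕ) (hn : 0 < n) : (S t n).ncard = avXCount t n := by
  have : S t n = {p : Pattern | p.1 = n ∧ (InX p ∧ ¬ Contains t p)} := by
    ext p
    simp only [S, XE, Set.mem_ofPred_eq]
    constructor
    · rintro ⟨h1, h2 | h2, h3⟩
      · omega
      · exact ⟨h1, h2, h3⟩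
    · rintro ⟨h1, h2, h3⟩
      exact ⟨h1, Or.inr h2, h3⟩
  rw [this, sized_eq, Set.ncard_image_of_injective _ sigma_mk_injective]
  rfl

lemma S_small (t u : Pattern) (n : ℕ) (ht : n < t.1) (hu : n < u.1) : S t n = S u n := by
  ext p
  simp only [S, Set.mem_ofPred_eq]
  refine and_congr_right fun h => and_congr_right fun _ => ?_
  constructor <;> intro _ hc <;> have := contains_size hc <;> omega

lemma recursion (t : Pattern) (h0 : 0 < t.1) (ht : pv t (t.1 - 1) ≠ t.1 - 1) (n : ℕ) :
    (S (op .sl t) (n + 2)).ncard + (S t n).ncard + (S (op .sl t) n).ncard =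
      (S t (n + 1)).ncard + 3 * (S (op .sl t) (n + 1)).ncard := by
  set u := op .sl t with hu
  have hus : u.1 = t.1 + 1 := op_size _ _
  have hbt := pv_lt t (i := t.1 - 1) (by omega)
  have hu0 : pv u 0 = 0 := by rw [hu, pv_sl t _ (by omega)]; simp
  have hul : pv u (u.1 - 1) = pv t (t.1 - 1) + 1 := by
    rw [hu, op_size, pv_sl t _ (by omega)]; simp; omega
  have c1 : ∀ p, Contains u (op .sl p) ↔ Contains t p := contains_sl_sl t
  have c2 : ∀ p, Contains u (op .sr p) ↔ Contains u p := fun p =>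
    contains_sr u p (fun _ => by omega)
  have c3 : ∀ p, Contains u (op .kl p) ↔ Contains u p := fun p =>
    contains_kl u p (fun _ => by omega)
  have c4 : ∀ p, Contains u (op .kr p) ↔ Contains u p := fun p =>
    contains_kr u p (fun _ => by omega)
  have c5 : ∀ p, Contains t (op .sr p) ↔ Contains t p := fun p =>
    contains_sr t p (fun _ => ht)
  have e1 : S u (n + 2) = (op .sl '' S t (n+1) ∪ op .sr '' S u (n+1)) ∪
      (op .kl '' S u (n+1) ∪ op .kr '' S u (n+1)) := by
    ext p
    constructor
    · rintro ⟨hp, hX, hc⟩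
      obtain ⟨a, q, hq, rfl⟩ := XE_cases hX (by omega)
      rw [op_size] at hp
      have hq1 : q.1 = n + 1 := by omega
      cases a
      · rw [c1] at hc; exact Or.inl (Or.inl ⟨q, ⟨hq1, hq, hc⟩, rfl⟩)
      · rw [c2] at hc; exact Or.inl (Or.inr ⟨q, ⟨hq1, hq, hc⟩, rfl⟩)
      · rw [c3] at hc; exact Or.inr (Or.inl ⟨q, ⟨hq1, hq, hc⟩, rfl⟩)
      · rw [c4] at hc; exact Or.inr (Or.inr ⟨q, ⟨hq1, hq, hc⟩, rfl⟩)
    · rintro ((⟨q, ⟨hq1, hq, hc⟩, rfl⟩ | ⟨q, ⟨hq1, hq, hc⟩, rfl⟩) |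
        (⟨q, ⟨hq1, hq, hc⟩, rfl⟩ | ⟨q, ⟨hq1, hq, hc⟩, rfl⟩))
      · exact ⟨by rw [op_size]; omega, (XE_iff _ _).mpr hq, by rwa [c1]⟩
      · exact ⟨by rw [op_size]; omega, (XE_iff _ _).mpr hq, by rwa [c2]⟩
      · exact ⟨by rw [op_size]; omega, (XE_iff _ _).mpr hq, by rwa [c3]⟩
      · exact ⟨by rw [op_size]; omega, (XE_iff _ _).mpr hq, by rwa [c4]⟩
  have e2 : op .sl '' S t (n+1) ∩ op .sr '' S u (n+1) = (fun s => op .sl (op .sr s)) '' S t n := by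
    ext p
    constructor
    · rintro ⟨⟨q, ⟨hq1, hq, hc⟩, rfl⟩, r, -, hr⟩
      obtain ⟨s, rfl, rfl⟩ := sum_split hr.symm (by omega)
      rw [op_size] at hq1
      exact ⟨s, ⟨by omega, (XE_iff _ _).mp hq, by rwa [c5] at hc⟩, rfl⟩
    · rintro ⟨s, ⟨hs, hX, hc⟩, rfl⟩
      refine ⟨⟨_, ⟨?_, (XE_iff _ _).mpr hX, ?_⟩, rfl⟩, op .sl s,
        ⟨?_, (XE_iff _ _).mpr hX, ?_⟩, (sum_comm s).symm⟩
      · rw [op_size, hs]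
      · rwa [c5]
      · rw [op_size, hs]
      · rwa [c1]
  have e3 : op .kl '' S u (n+1) ∩ op .kr '' S u (n+1) = (fun s => op .kl (op .kr s)) '' S u n := by
    ext p
    constructor
    · rintro ⟨⟨q, ⟨hq1, hq, hc⟩, rfl⟩, r, -, hr⟩
      obtain ⟨s, rfl, rfl⟩ := skew_split hr.symm (by omega)
      rw [op_size] at hq1
      exact ⟨s, ⟨by omega, (XE_iff _ _).mp hq, by rwa [c4] at hc⟩, rfl⟩
    · rintro ⟨s, ⟨hs, hX, hc⟩, rfl⟩
      refine ⟨⟨_, ⟨?_, (XE_iff _ _).mpr hX, ?_⟩, rfl⟩, op .kl s,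
        ⟨?_, (XE_iff _ _).mpr hX, ?_⟩, (skew_comm s).symm⟩
      · rw [op_size, hs]
      · rwa [c4]
      · rw [op_size, hs]
      · rwa [c3]
  have e4 : Disjoint (op .sl '' S t (n+1) ∪ op .sr '' S u (n+1))
      (op .kl '' S u (n+1) ∪ op .kr '' S u (n+1)) := by
    rw [Set.disjoint_left]
    rintro p (⟨q, ⟨hq, -⟩, rfl⟩ | ⟨q, ⟨hq, -⟩, rfl⟩) (⟨r, -, hr⟩ | ⟨r, -, hr⟩) <;>
      exact sum_ne_skew (by simp [isSum]) (by simp [isSum]) (by omega) hr.symm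
  have inj : ∀ a, Function.Injective (op a) := fun a p q h => op_inj a h
  have inj2 : ∀ a b, Function.Injective (fun s => op a (op b s)) :=
    fun a b p q h => op_inj b (op_inj a h)
  have fin : ∀ a v m, (op a '' S v m).Finite := fun a v m => (S_finite v m).image _
  have f1 := Set.ncard_union_add_ncard_inter _ _ (fin .sl t (n+1)) (fin .sr u (n+1))
  have f2 := Set.ncard_union_add_ncard_inter _ _ (fin .kl u (n+1)) (fin .kr u (n+1))
  have f3 := Set.ncard_union_eq e4 ((fin _ _ _).union (fin _ _ _)) ((fin _ _ _).union (fin _ _ _))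
  rw [e2, Set.ncard_image_of_injective _ (inj2 .sl .sr),
    Set.ncard_image_of_injective _ (inj _), Set.ncard_image_of_injective _ (inj _)] at f1
  rw [e3, Set.ncard_image_of_injective _ (inj2 .kl .kr),
    Set.ncard_image_of_injective _ (inj _), Set.ncard_image_of_injective _ (inj _)] at f2
  rw [← e1] at f3
  omega

lemma inX_pos {p : Pattern} (h : InX p) : 0 < p.1 := by
  rcases inX_cases h with rfl | ⟨a, q, -, rfl⟩
  · exact Nat.one_pos
  · rw [op_size]; omega

lemma not_endsWithMax {p : Pattern} (h0 : 0 < p.1) (h : ¬ EndsWithMax p) :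
    pv p (p.1 - 1) ≠ p.1 - 1 := by
  intro hc
  apply h
  refine ⟨h0, Fin.ext ?_⟩
  have : p.1 - 1 < p.1 := by omega
  simpa [pv, this] using hc

end OneSum

open OneSum in
/-- if θ, τ ∈ X are Wilf-equivalent in X and neither ends with its
maximum, then 1 ⊕ θ and 1 ⊕ τ are Wilf-equivalent in X. -/
theorem one_sum_wilf_equiv (θ τ : Pattern) (hθ : InX θ) (hτ : InX τ)
    (h : WilfEquivX θ τ) (hθm : ¬ EndsWithMax θ) (hτm : ¬ EndsWithMax τ) :
    WilfEquivX (sumP onePat θ) (sumP onePat τ) := by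
  have pθ := inX_pos hθ
  have pτ := inX_pos hτ
  have sθ := op_size .sl θ
  have sτ := op_size .sl τ
  have ha : ∀ n, (S θ n).ncard = (S τ n).ncard := by
    intro n
    rcases Nat.eq_zero_or_pos n with rfl | hn
    · rw [S_small θ τ 0 pθ pτ]
    · rw [S_card _ _ hn, S_card _ _ hn, h n]
  have hb : ∀ n, (S (op .sl θ) n).ncard = (S (op .sl τ) n).ncard ∧
      (S (op .sl θ) (n + 1)).ncard = (S (op .sl τ) (n + 1)).ncard := by
    intro n
    induction n with
    | zero =>
      exact ⟨by rw [S_small _ (op .sl τ) 0 (by omega) (by omega)],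
        by rw [S_small _ (op .sl τ) 1 (by omega) (by omega)]⟩
    | succ n ih =>
      refine ⟨ih.2, ?_⟩
      have r1 := recursion θ pθ (not_endsWithMax pθ hθm) n
      have r2 := recursion τ pτ (not_endsWithMax pτ hτm) n
      have := ha n
      have := ha (n + 1)
      have := ih.1
      have := ih.2
      show (S (op .sl θ) (n + 2)).ncard = (S (op .sl τ) (n + 2)).ncard
      omega
  intro n
  rcases Nat.eq_zero_or_pos n with rfl | hn
  · have z : ∀ p : Pattern, avXCount p 0 = 0 := by
      intro p
      have : IsEmpty {σ : Equiv.Perm (Fin 0) // InX ⟨0, σ⟩ ∧ ¬ Contains p ⟨0, σ⟩} :=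
        ⟨fun x => absurd (inX_pos x.2.1) (by simp)⟩
      exact Nat.card_of_isEmpty
    rw [z, z]
  · rw [← S_card _ _ hn, ← S_card _ _ hn]
    exact (hb n).1
end

section
/- Let w_n be the number of Wilf-equivalence classes of permutations of size n in the class X. Then w_n^{1/n} → 1 as n → ∞. Consequently, since |X_n|^{1/n} → 2 + √2, the class X exhibits an exponential Wilf-collapse: w_n = o(r^n |X_n|) for every r with 1/(2+√2) < r < 1. -/
open Equiv Filter

/-- Membership in X, with the empty permutation included (for size 0). -/
def InX0 (p : Pattern) : Prop := InX p ∨ p.1 = 0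

/-- The number of permutations of size n in the class X. -/
noncomputable def xcount (n : ℕ) : ℕ :=
  Nat.card {σ : Equiv.Perm (Fin n) // InX0 ⟨n, σ⟩}

/-- The number of Wilf-equivalence classes of permutations of size n in X. -/
noncomputable def wcount (n : ℕ) : ℕ :=
  Nat.card (Quot (fun σ σ' : {σ : Equiv.Perm (Fin n) // InX ⟨n, σ⟩} =>
    WilfEquivX ⟨n, σ.1⟩ ⟨n, σ'.1⟩))


namespace XC

def sL (p : Pattern) : Pattern := sumP onePat p
def sR (p : Pattern) : Pattern := sumP p onePat
def kL (p : Pattern) : Pattern := skewP onePat p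
def kR (p : Pattern) : Pattern := skewP p onePat

@[simp] lemma sL_fst (p : Pattern) : (sL p).1 = p.1 + 1 := Nat.add_comm 1 p.1
@[simp] lemma sR_fst (p : Pattern) : (sR p).1 = p.1 + 1 := rfl
@[simp] lemma kL_fst (p : Pattern) : (kL p).1 = p.1 + 1 := Nat.add_comm 1 p.1
@[simp] lemma kR_fst (p : Pattern) : (kR p).1 = p.1 + 1 := rfl

/-- Values of a pattern as a function on the naturals. -/
def pv (p : Pattern) (i : ℕ) : ℕ := if h : i < p.1 then (p.2 ⟨i, h⟩ : ℕ) else 0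

lemma pv_mk (n : ℕ) (σ : Equiv.Perm (Fin n)) (i : Fin n) : pv ⟨n, σ⟩ i = σ i := by
  simp only [pv]
  rw [dif_pos i.2]

lemma pv_fin (p : Pattern) (i : Fin p.1) : (p.2 i : ℕ) = pv p i := (pv_mk p.1 p.2 i).symm

lemma pat_ext {p q : Pattern} (h : p.1 = q.1) (h2 : ∀ i, i < p.1 → pv p i = pv q i) : p = q := by
  obtain ⟨n, σ⟩ := p
  obtain ⟨m, τ⟩ := q
  obtain rfl : n = m := h
  congr 1
  ext i
  have := h2 i i.2
  rwa [pv_mk, pv_mk] at this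

lemma pv_lt {p : Pattern} {i : ℕ} (h : i < p.1) : pv p i < p.1 := by
  rw [← pv_fin p ⟨i, h⟩]; exact (p.2 _).2

lemma pv_inj {p : Pattern} {i j : ℕ} (hi : i < p.1) (hj : j < p.1) (h : pv p i = pv p j) :
    i = j := by
  rw [← pv_fin p ⟨i, hi⟩, ← pv_fin p ⟨j, hj⟩] at h
  exact congrArg Fin.val (p.2.injective (Fin.ext h))

lemma pv_surj {p : Pattern} {v : ℕ} (h : v < p.1) : ∃ i, i < p.1 ∧ pv p i = v := by
  obtain ⟨t, ht⟩ := p.2.surjective ⟨v, h⟩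
  exact ⟨t, t.2, by rw [← pv_fin, ht]⟩

lemma contains_iff {p q : Pattern} : Contains p q ↔ ∃ f : ℕ → ℕ, (∀ i, i < p.1 → f i < q.1) ∧
    (∀ i j, i < j → j < p.1 → f i < f j) ∧
    ∀ s t, s < p.1 → t < p.1 → (pv p s < pv p t ↔ pv q (f s) < pv q (f t)) := by
  constructor
  · rintro ⟨f, hf, h⟩
    let g : ℕ → ℕ := fun i => if h : i < p.1 then (f ⟨i, h⟩ : ℕ) else 0
    have hg : ∀ i (h : i < p.1), g i = f ⟨i, h⟩ := fun i h => dif_pos h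
    refine ⟨g, ?_, ?_, ?_⟩
    · intro i hi; rw [hg i hi]; exact (f _).2
    · intro i j hij hj
      rw [hg i (hij.trans hj), hg j hj]
      exact hf hij
    · intro s t hs ht
      rw [hg s hs, hg t ht, ← pv_fin, ← pv_fin, ← pv_fin p ⟨s, hs⟩, ← pv_fin p ⟨t, ht⟩]
      exact h _ _
  · rintro ⟨f, h1, h2, h3⟩
    refine ⟨fun i => ⟨f i, h1 i i.2⟩, fun i j hij => h2 i j hij j.2, fun s t => ?_⟩
    have := h3 s t s.2 t.2
    rw [Fin.lt_def, Fin.lt_def, pv_fin, pv_fin, pv_fin, pv_fin]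
    exact this

lemma sumPerm_castAdd {m n : ℕ} (α : Equiv.Perm (Fin m)) (β : Equiv.Perm (Fin n)) (i : Fin m) :
    sumPerm α β (Fin.castAdd n i) = Fin.castAdd n (α i) := by
  simp [sumPerm]

lemma sumPerm_natAdd {m n : ℕ} (α : Equiv.Perm (Fin m)) (β : Equiv.Perm (Fin n)) (i : Fin n) :
    sumPerm α β (Fin.natAdd m i) = Fin.natAdd m (β i) := by
  simp [sumPerm]

lemma skewPerm_castAdd {m n : ℕ} (α : Equiv.Perm (Fin m)) (β : Equiv.Perm (Fin n)) (i : Fin m) :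
    (skewPerm α β (Fin.castAdd n i) : ℕ) = n + α i := by
  simp [skewPerm, Nat.add_comm]

lemma skewPerm_natAdd {m n : ℕ} (α : Equiv.Perm (Fin m)) (β : Equiv.Perm (Fin n)) (i : Fin n) :
    (skewPerm α β (Fin.natAdd m i) : ℕ) = β i := by
  simp [skewPerm]

@[simp] lemma sL_zero (p : Pattern) : pv (sL p) 0 = 0 := by
  obtain ⟨n, σ⟩ := p
  have := pv_mk (1 + n) (sumPerm 1 σ) (Fin.castAdd n 0)
  rw [sumPerm_castAdd] at this
  exact this

lemma sL_succ {p : Pattern} {i : ℕ} (h : i < p.1) : pv (sL p) (i + 1) = pv p i + 1 := by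
  obtain ⟨n, σ⟩ := p
  have := pv_mk (1 + n) (sumPerm 1 σ) (Fin.natAdd 1 ⟨i, h⟩)
  rw [sumPerm_natAdd, Fin.val_natAdd, Fin.val_natAdd, ← pv_mk] at this
  rw [Nat.add_comm i, Nat.add_comm _ 1]
  exact this

lemma sR_lt {p : Pattern} {i : ℕ} (h : i < p.1) : pv (sR p) i = pv p i := by
  obtain ⟨n, σ⟩ := p
  have := pv_mk (n + 1) (sumPerm σ 1) (Fin.castAdd 1 ⟨i, h⟩)
  rw [sumPerm_castAdd, Fin.val_castAdd, Fin.val_castAdd, ← pv_mk] at this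
  exact this

lemma sR_last {p : Pattern} {i : ℕ} (h : i = p.1) : pv (sR p) i = p.1 := by
  obtain ⟨n, σ⟩ := p
  change i = n at h
  subst h
  have := pv_mk (i + 1) (sumPerm σ 1) (Fin.natAdd i 0)
  rw [sumPerm_natAdd] at this
  exact this

@[simp] lemma kL_zero (p : Pattern) : pv (kL p) 0 = p.1 := by
  obtain ⟨n, σ⟩ := p
  have := pv_mk (1 + n) (skewPerm 1 σ) (Fin.castAdd n 0)
  rw [skewPerm_castAdd] at this
  exact this

lemma kL_succ {p : Pattern} {i : ℕ} (h : i < p.1) : pv (kL p) (i + 1) = pv p i := by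
  obtain ⟨n, σ⟩ := p
  have := pv_mk (1 + n) (skewPerm 1 σ) (Fin.natAdd 1 ⟨i, h⟩)
  rw [skewPerm_natAdd, Fin.val_natAdd, ← pv_mk] at this
  rw [Nat.add_comm i]
  exact this

lemma kR_lt {p : Pattern} {i : ℕ} (h : i < p.1) : pv (kR p) i = pv p i + 1 := by
  obtain ⟨n, σ⟩ := p
  have := pv_mk (n + 1) (skewPerm σ 1) (Fin.castAdd 1 ⟨i, h⟩)
  rw [skewPerm_castAdd, Fin.val_castAdd, ← pv_mk] at this
  rw [Nat.add_comm _ 1]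
  exact this

lemma kR_last {p : Pattern} {i : ℕ} (h : i = p.1) : pv (kR p) i = 0 := by
  obtain ⟨n, σ⟩ := p
  change i = n at h
  subst h
  have := pv_mk (i + 1) (skewPerm σ 1) (Fin.natAdd i 0)
  rw [skewPerm_natAdd] at this
  exact this

/-- complement -/
def compl (p : Pattern) : Pattern := ⟨p.1, p.2.trans Fin.revPerm⟩
/-- reverse complement -/
def rc (p : Pattern) : Pattern := ⟨p.1, (Fin.revPerm.trans p.2).trans Fin.revPerm⟩

@[simp] lemma compl_fst (p : Pattern) : (compl p).1 = p.1 := rfl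
@[simp] lemma rc_fst (p : Pattern) : (rc p).1 = p.1 := rfl

lemma compl_pv {p : Pattern} {i : ℕ} (h : i < p.1) : pv (compl p) i = p.1 - (pv p i + 1) := by
  obtain ⟨n, σ⟩ := p
  have := pv_mk n (σ.trans Fin.revPerm) ⟨i, h⟩
  rw [Equiv.trans_apply, Fin.revPerm_apply, Fin.val_rev, ← pv_mk] at this
  exact this

lemma rc_pv {p : Pattern} {i : ℕ} (h : i < p.1) :
    pv (rc p) i = p.1 - (pv p (p.1 - (i + 1)) + 1) := by
  obtain ⟨n, σ⟩ := p
  have := pv_mk n ((Fin.revPerm.trans σ).trans Fin.revPerm) ⟨i, h⟩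
  rw [Equiv.trans_apply, Equiv.trans_apply, Fin.revPerm_apply, Fin.revPerm_apply,
    Fin.val_rev, ← pv_mk, Fin.val_rev] at this
  exact this

@[simp] lemma compl_compl (p : Pattern) : compl (compl p) = p := by
  refine pat_ext rfl fun i hi => ?_
  have hi' : i < p.1 := hi
  have := pv_lt hi'
  rw [compl_pv (by simpa using hi), compl_pv hi', compl_fst]
  omega

@[simp] lemma rc_rc (p : Pattern) : rc (rc p) = p := by
  refine pat_ext rfl fun i hi => ?_
  have hi' : i < p.1 := hi
  rw [rc_pv (by simpa using hi), rc_fst, rc_pv (by omega)]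
  have : p.1 - (p.1 - (i + 1) + 1) = i := by omega
  rw [this]
  have := pv_lt hi'
  omega

lemma compl_sL (p : Pattern) : compl (sL p) = kL (compl p) := by
  refine pat_ext (by simp) fun i hi => ?_
  rw [compl_pv (p := sL p) hi]
  rcases i with _ | i
  · simp
  · have h' : i < p.1 := by simp at hi; omega
    rw [sL_succ h', kL_succ (p := compl p) h', compl_pv h', sL_fst]
    omega

lemma compl_sR (p : Pattern) : compl (sR p) = kR (compl p) := by
  refine pat_ext (by simp) fun i hi => ?_
  rw [compl_pv (p := sR p) hi]
  have : i < p.1 ∨ i = p.1 := by simp at hi; omega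
  rcases this with h' | h'
  · rw [sR_lt h', kR_lt (p := compl p) h', compl_pv h', sR_fst]
    have := pv_lt h'
    omega
  · rw [sR_last h', kR_last (p := compl p) h']
    simp

lemma rc_sL (p : Pattern) : rc (sL p) = sR (rc p) := by
  refine pat_ext (by simp) fun i hi => ?_
  rw [rc_pv (p := sL p) hi]
  have : i < p.1 ∨ i = p.1 := by simp at hi; omega
  rcases this with h' | h'
  · rw [sR_lt (p := rc p) h', rc_pv h', sL_fst, show p.1 + 1 - (i + 1) = p.1 - (i + 1) + 1 by omega,
      sL_succ (by omega)]
    omega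
  · rw [sR_last (p := rc p) h', h']
    simp

lemma rc_sR (p : Pattern) : rc (sR p) = sL (rc p) := by
  rw [← rc_rc (sL (rc p)), rc_sL, rc_rc]

lemma compl_kL (p : Pattern) : compl (kL p) = sL (compl p) := by
  rw [← compl_compl (sL (compl p)), compl_sL, compl_compl]

lemma compl_kR (p : Pattern) : compl (kR p) = sR (compl p) := by
  rw [← compl_compl (sR (compl p)), compl_sR, compl_compl]

lemma sL_sR (p : Pattern) : sL (sR p) = sR (sL p) := by
  refine pat_ext (by simp) fun i hi => ?_
  rcases i with _ | i
  · rw [sL_zero, sR_lt (by simp), sL_zero]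
  · have : i < p.1 ∨ i = p.1 := by simp at hi; omega
    rw [sL_succ (by simp; omega)]
    rcases this with h' | h'
    · rw [sR_lt h', sR_lt (by simp; omega), sL_succ h']
    · rw [sR_last h', sR_last (by simp [h'])]
      simp

lemma sL_inj : Function.Injective sL := by
  intro p q h
  have h1 : p.1 = q.1 := by
    have := congrArg Sigma.fst h
    simpa using this
  refine pat_ext h1 fun i hi => ?_
  have := congrArg (fun r => pv r (i + 1)) h
  simp only [sL_succ hi, sL_succ (h1 ▸ hi)] at this
  omega

lemma compl_inj : Function.Injective compl := fun p q h => by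
  rw [← compl_compl p, h, compl_compl]

lemma rc_inj : Function.Injective rc := fun p q h => by
  rw [← rc_rc p, h, rc_rc]

lemma sR_inj : Function.Injective sR := fun p q h => by
  apply rc_inj; apply sL_inj; rw [← rc_sR, ← rc_sR, h]

lemma kL_inj : Function.Injective kL := fun p q h => by
  apply compl_inj; apply sL_inj; rw [← compl_kL, ← compl_kL, h]

lemma kR_inj : Function.Injective kR := fun p q h => by
  apply compl_inj; apply sR_inj; rw [← compl_kR, ← compl_kR, h]

lemma kL_kR (p : Pattern) : kL (kR p) = kR (kL p) := by
  apply compl_inj; rw [compl_kL, compl_kR, compl_kR, compl_kL, sL_sR]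

lemma contains_compl_aux {p q : Pattern} (h : Contains p q) : Contains (compl p) (compl q) := by
  rw [contains_iff] at h ⊢
  obtain ⟨f, h1, h2, h3⟩ := h
  refine ⟨f, h1, h2, fun s t hs ht => ?_⟩
  simp only [compl_fst] at hs ht
  rw [compl_pv hs, compl_pv ht, compl_pv (h1 s hs), compl_pv (h1 t ht)]
  have := h3 t s ht hs
  have := pv_lt hs
  have := pv_lt ht
  have := pv_lt (h1 s hs)
  have := pv_lt (h1 t ht)
  omega

lemma contains_compl {p q : Pattern} : Contains (compl p) (compl q) ↔ Contains p q :=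
  ⟨fun h => by simpa using contains_compl_aux h, contains_compl_aux⟩

lemma contains_rc_aux {p q : Pattern} (h : Contains p q) : Contains (rc p) (rc q) := by
  rw [contains_iff] at h ⊢
  obtain ⟨f, h1, h2, h3⟩ := h
  simp only [rc_fst]
  have hl : ∀ i, i < p.1 → p.1 - (i + 1) < p.1 := fun i hi => by omega
  refine ⟨fun i => q.1 - (f (p.1 - (i + 1)) + 1), ?_, ?_, ?_⟩
  · intro i hi
    have := h1 _ (hl i hi)
    show q.1 - (f (p.1 - (i + 1)) + 1) < q.1
    omega
  · intro i j hij hj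
    show q.1 - (f (p.1 - (i + 1)) + 1) < q.1 - (f (p.1 - (j + 1)) + 1)
    have := h1 _ (hl i (by omega))
    have := h2 (p.1 - (j + 1)) (p.1 - (i + 1)) (by omega) (by omega)
    omega
  · intro s t hs ht
    have a1 := h1 _ (hl s hs)
    have a2 := h1 _ (hl t ht)
    show _ ↔ pv (rc q) (q.1 - (f (p.1 - (s + 1)) + 1)) < pv (rc q) (q.1 - (f (p.1 - (t + 1)) + 1))
    rw [rc_pv hs, rc_pv ht, rc_pv (by omega), rc_pv (by omega)]
    rw [show q.1 - (q.1 - (f (p.1 - (s + 1)) + 1) + 1) = f (p.1 - (s + 1)) by omega,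
      show q.1 - (q.1 - (f (p.1 - (t + 1)) + 1) + 1) = f (p.1 - (t + 1)) by omega]
    have := h3 _ _ (hl t ht) (hl s hs)
    have := pv_lt (hl s hs)
    have := pv_lt (hl t ht)
    have := pv_lt a1
    have := pv_lt a2
    omega

lemma contains_rc {p q : Pattern} : Contains (rc p) (rc q) ↔ Contains p q :=
  ⟨fun h => by simpa using contains_rc_aux h, contains_rc_aux⟩

lemma exists_sL {p : Pattern} (h : 0 < p.1) (h0 : pv p 0 = 0) : ∃ r, p = sL r := by
  have hpos : ∀ i, i + 1 < p.1 → 0 < pv p (i + 1) := by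
    intro i hi
    rcases Nat.eq_zero_or_pos (pv p (i + 1)) with h1 | h1
    · have := pv_inj hi h (h1.trans h0.symm)
      omega
    · exact h1
  let g : Fin (p.1 - 1) → Fin (p.1 - 1) := fun i => ⟨pv p (i + 1) - 1, by
    have hi : (i : ℕ) + 1 < p.1 := by have := i.2; omega
    have := hpos i hi
    have := pv_lt hi
    omega⟩
  have hg : Function.Injective g := by
    intro i j hij
    have h1 : pv p (i + 1) - 1 = pv p (j + 1) - 1 := congrArg Fin.val hij
    have hi : (i : ℕ) + 1 < p.1 := by have := i.2; omega
    have hj : (j : ℕ) + 1 < p.1 := by have := j.2; omega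
    have := hpos i hi
    have := hpos j hj
    have := pv_inj hi hj (by omega)
    exact Fin.ext (by omega)
  let τ := Equiv.ofBijective g (Finite.injective_iff_bijective.1 hg)
  refine ⟨⟨p.1 - 1, τ⟩, pat_ext (by simp; omega) ?_⟩
  rintro (_ | i) hi
  · rw [sL_zero, h0]
  · have h' : i < p.1 - 1 := by omega
    have e := pv_mk (p.1 - 1) τ ⟨i, h'⟩
    have e2 : (τ ⟨i, h'⟩ : ℕ) = pv p (i + 1) - 1 := rfl
    have e3 := sL_succ (p := ⟨p.1 - 1, τ⟩) h'
    have := hpos i hi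
    simp only at e
    omega

lemma sL_eq_sR {p q : Pattern} (h : sL q = sR p) (hq : 0 < q.1) :
    ∃ r, q = sR r ∧ p = sL r := by
  have hs : (sL q).1 = (sR p).1 := congrArg Sigma.fst h
  simp only [sL_fst, sR_fst] at hs
  have hp : 0 < p.1 := by omega
  have := congrArg (fun r => pv r 0) h
  simp only [sL_zero, sR_lt hp] at this
  obtain ⟨r, rfl⟩ := exists_sL hp this.symm
  exact ⟨r, sL_inj (by rw [h, sL_sR]), rfl⟩

lemma kL_eq_kR {p q : Pattern} (h : kL q = kR p) (hq : 0 < q.1) :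
    ∃ r, q = kR r ∧ p = kL r := by
  have : sL (compl q) = sR (compl p) := by rw [← compl_kL, h, compl_kR]
  obtain ⟨r, h1, h2⟩ := sL_eq_sR this hq
  refine ⟨compl r, ?_, ?_⟩
  · rw [← compl_sR, ← h1, compl_compl]
  · rw [← compl_sL, ← h2, compl_compl]

lemma sL_ne_kL {p q : Pattern} (hq : 0 < q.1) : sL q ≠ kL p := by
  intro h
  have hs : (sL q).1 = (kL p).1 := congrArg Sigma.fst h
  have := congrArg (fun r => pv r 0) h
  simp at this hs
  omega

lemma sL_ne_kR {p q : Pattern} (hq : 0 < q.1) : sL q ≠ kR p := by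
  intro h
  have hs : (sL q).1 = (kR p).1 := congrArg Sigma.fst h
  have := congrArg (fun r => pv r 0) h
  simp at hs
  simp only [sL_zero, kR_lt (show 0 < p.1 by omega)] at this
  omega

lemma sR_ne_kL {p q : Pattern} (hq : 0 < q.1) : sR q ≠ kL p := by
  intro h
  apply sL_ne_kR (q := compl p) (p := compl q)
  · have hs : (sR q).1 = (kL p).1 := congrArg Sigma.fst h
    simp at hs ⊢; omega
  · rw [← compl_kL, ← h, compl_sR]

lemma sR_ne_kR {p q : Pattern} (hq : 0 < q.1) : sR q ≠ kR p := by
  intro h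
  have hs : (sR q).1 = (kR p).1 := congrArg Sigma.fst h
  simp at hs
  have := congrArg (fun r => pv r q.1) h
  simp only [sR_last (p := q) rfl, kR_last hs] at this
  omega

lemma contains_of_shift {p q : Pattern} (f : ℕ → ℕ) (h1 : ∀ i, i < p.1 → f i < (sL q).1)
    (h2 : ∀ i j, i < j → j < p.1 → f i < f j)
    (h3 : ∀ s t, s < p.1 → t < p.1 → (pv p s < pv p t ↔ pv (sL q) (f s) < pv (sL q) (f t)))
    (hpos : ∀ i, i < p.1 → 0 < f i) : Contains p q := by
  rw [contains_iff]
  have hlt : ∀ i, i < p.1 → f i - 1 < q.1 := fun i hi => by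
    have := h1 i hi
    have := hpos i hi
    simp only [sL_fst] at *
    omega
  have hv : ∀ i, i < p.1 → pv (sL q) (f i) = pv q (f i - 1) + 1 := by
    intro i hi
    have := hpos i hi
    rw [← sL_succ (hlt i hi)]
    congr 1
    omega
  refine ⟨fun i => f i - 1, hlt, ?_, ?_⟩
  · intro i j hij hj
    have := h2 i j hij hj
    have := hpos i (by omega)
    show f i - 1 < f j - 1
    omega
  · intro s t hs ht
    rw [h3 s t hs ht, hv s hs, hv t ht]
    show _ ↔ pv q (f s - 1) < pv q (f t - 1)
    omega

lemma contains_sL_of {p q : Pattern} (h : Contains p q) : Contains p (sL q) := by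
  rw [contains_iff] at h ⊢
  obtain ⟨f, h1, h2, h3⟩ := h
  refine ⟨fun i => f i + 1, ?_, ?_, ?_⟩
  · intro i hi
    have := h1 i hi
    simpa using this
  · intro i j hij hj
    have := h2 i j hij hj
    simpa using this
  · intro s t hs ht
    show _ ↔ pv (sL q) (f s + 1) < pv (sL q) (f t + 1)
    rw [h3 s t hs ht, sL_succ (h1 s hs), sL_succ (h1 t ht)]
    omega

lemma contains_sL_iff {p q : Pattern} (hp : ¬ ∃ r, p = sL r) :
    Contains p (sL q) ↔ Contains p q := by
  refine ⟨?_, contains_sL_of⟩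
  intro hc
  rw [contains_iff] at hc
  obtain ⟨f, h1, h2, h3⟩ := hc
  apply contains_of_shift f h1 h2 h3
  intro i hi
  by_contra hi0
  have hi0 : f i = 0 := by omega
  apply hp
  have h0 : 0 < p.1 := by omega
  have hi1 : i = 0 := by
    by_contra hne
    have := h2 0 i (by omega) hi
    omega
  subst hi1
  apply exists_sL h0
  by_contra hne
  obtain ⟨t, ht, ht0⟩ := pv_surj h0
  have := (h3 t 0 ht h0).1 (by omega)
  rw [hi0, sL_zero] at this
  omega

lemma contains_sL_sL {p q : Pattern} : Contains (sL p) (sL q) ↔ Contains p q := by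
  constructor
  · intro hc
    rw [contains_iff] at hc
    obtain ⟨f, h1, h2, h3⟩ := hc
    simp only [sL_fst] at h1 h2 h3
    refine contains_of_shift (fun i => f (i + 1)) ?_ ?_ ?_ ?_
    · intro i hi
      simpa using h1 (i + 1) (by omega)
    · intro i j hij hj
      exact h2 _ _ (by omega) (by omega)
    · intro s t hs ht
      have := h3 (s + 1) (t + 1) (by omega) (by omega)
      rw [sL_succ hs, sL_succ ht] at this
      show _ ↔ pv (sL q) (f (s + 1)) < pv (sL q) (f (t + 1))
      omega
    · intro i hi
      have := h2 0 (i + 1) (by omega) (by omega)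
      show 0 < f (i + 1)
      omega
  · intro hc
    rw [contains_iff] at hc ⊢
    obtain ⟨f, h1, h2, h3⟩ := hc
    simp only [sL_fst]
    let g : ℕ → ℕ := fun i => Nat.casesOn i 0 (fun j => f j + 1)
    have g0 : g 0 = 0 := rfl
    have g1 : ∀ i, g (i + 1) = f i + 1 := fun i => rfl
    refine ⟨g, ?_, ?_, ?_⟩
    · rintro (_ | i) hi
      · simp [g0]
      · have := h1 i (by omega)
        rw [g1]; omega
    · rintro (_ | i) (_ | j) hij hj
      · omega
      · rw [g0, g1]; omega
      · omega
      · have := h2 i j (by omega) (by omega)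
        rw [g1, g1]; omega
    · rintro (_ | s) (_ | t) hs ht
      · simp
      · rw [g0, g1, sL_zero, sL_zero, sL_succ (by omega), sL_succ (h1 _ (by omega))]
        omega
      · rw [g0, g1, sL_zero, sL_zero]
        omega
      · have := h3 s t (by omega) (by omega)
        rw [g1, g1, sL_succ (by omega), sL_succ (by omega), sL_succ (h1 _ (by omega)),
          sL_succ (h1 _ (by omega))]
        omega

lemma contains_sR_sR {p q : Pattern} : Contains (sR p) (sR q) ↔ Contains p q := by
  rw [← contains_rc, rc_sR, rc_sR, contains_sL_sL, contains_rc]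

lemma contains_sR_iff {p q : Pattern} (hp : ¬ ∃ r, p = sR r) :
    Contains p (sR q) ↔ Contains p q := by
  rw [← contains_rc, rc_sR, contains_sL_iff, contains_rc]
  rintro ⟨r, hr⟩
  exact hp ⟨rc r, by rw [← rc_sL, ← hr, rc_rc]⟩

lemma contains_kL_iff {p q : Pattern} (hp : ¬ ∃ r, p = kL r) :
    Contains p (kL q) ↔ Contains p q := by
  rw [← contains_compl, compl_kL, contains_sL_iff, contains_compl]
  rintro ⟨r, hr⟩
  exact hp ⟨compl r, by rw [← compl_sL, ← hr, compl_compl]⟩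

lemma contains_kR_iff {p q : Pattern} (hp : ¬ ∃ r, p = kR r) :
    Contains p (kR q) ↔ Contains p q := by
  rw [← contains_compl, compl_kR, contains_sR_iff, contains_compl]
  rintro ⟨r, hr⟩
  exact hp ⟨compl r, by rw [← compl_sR, ← hr, compl_compl]⟩


lemma eq_of_size_zero {p q : Pattern} (hp : p.1 = 0) (hq : q.1 = 0) : p = q :=
  pat_ext (by omega) fun i hi => by omega

lemma eq_of_size_one {p q : Pattern} (hp : p.1 = 1) (hq : q.1 = 1) : p = q :=
  pat_ext (by omega) fun i hi => by
    have := pv_lt hi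
    have := pv_lt (p := q) (i := i) (by omega)
    omega

lemma inX_pos {p : Pattern} (h : InX p) : 0 < p.1 := by
  cases h with
  | base => exact Nat.one_pos
  | sumL h => exact Nat.add_pos_left Nat.one_pos _
  | skewL h => exact Nat.add_pos_left Nat.one_pos _
  | sumR h => exact Nat.succ_pos _
  | skewR h => exact Nat.succ_pos _

lemma inX_compl {p : Pattern} (h : InX p) : InX (compl p) := by
  induction h with
  | base => exact (eq_of_size_one rfl rfl : onePat = compl onePat) ▸ InX.base
  | @sumL p h ih => 
    change InX (compl (sL p))
    rw [compl_sL]; exact InX.skewL ih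
  | @skewL p h ih => 
    change InX (compl (kL p))
    rw [compl_kL]; exact InX.sumL ih
  | @sumR p h ih => 
    change InX (compl (sR p))
    rw [compl_sR]; exact InX.skewR ih
  | @skewR p h ih => 
    change InX (compl (kR p))
    rw [compl_kR]; exact InX.sumR ih

lemma rc_compl (p : Pattern) : rc (compl p) = compl (rc p) := by
  refine pat_ext rfl fun i hi => ?_
  change i < p.1 at hi
  rw [rc_pv (p := compl p) hi, compl_pv (p := rc p) hi, rc_pv hi, compl_fst,
    compl_pv (show p.1 - (i + 1) < p.1 by omega), rc_fst]

lemma rc_kL (p : Pattern) : rc (kL p) = kR (rc p) := by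
  apply compl_inj
  rw [← rc_compl, compl_kL, rc_sL, compl_kR, rc_compl]

lemma rc_kR (p : Pattern) : rc (kR p) = kL (rc p) := by
  apply compl_inj
  rw [← rc_compl, compl_kR, rc_sR, compl_kL, rc_compl]

lemma inX_rc {p : Pattern} (h : InX p) : InX (rc p) := by
  induction h with
  | base => exact (eq_of_size_one rfl rfl : onePat = rc onePat) ▸ InX.base
  | @sumL p h ih => 
    change InX (rc (sL p))
    rw [rc_sL]; exact InX.sumR ih
  | @skewL p h ih => 
    change InX (rc (kL p))
    rw [rc_kL]; exact InX.skewR ih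
  | @sumR p h ih => 
    change InX (rc (sR p))
    rw [rc_sR]; exact InX.sumL ih
  | @skewR p h ih => 
    change InX (rc (kR p))
    rw [rc_kR]; exact InX.skewL ih

lemma inX0_compl {p : Pattern} (h : InX0 p) : InX0 (compl p) := h.imp inX_compl id
lemma inX0_rc {p : Pattern} (h : InX0 p) : InX0 (rc p) := h.imp inX_rc id

lemma inX0_sL {p : Pattern} (h : InX0 p) : InX0 (sL p) := by
  rcases h with h | h
  · exact Or.inl (InX.sumL h)
  · left
    rw [eq_of_size_one (p := sL p) (q := onePat) (by simp [h]) rfl]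
    exact InX.base

lemma inX0_sR {p : Pattern} (h : InX0 p) : InX0 (sR p) := by
  have := inX0_rc (inX0_sL (inX0_rc h))
  rwa [rc_sL, rc_rc] at this

lemma inX0_kL {p : Pattern} (h : InX0 p) : InX0 (kL p) := by
  have := inX0_compl (inX0_sL (inX0_compl h))
  rwa [compl_sL, compl_compl] at this

lemma inX0_kR {p : Pattern} (h : InX0 p) : InX0 (kR p) := by
  have := inX0_compl (inX0_sR (inX0_compl h))
  rwa [compl_sR, compl_compl] at this

lemma inX0_of_sL_aux {p : Pattern} (h : InX p) : ∀ q, sL q = p → InX0 q := by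
  induction h with
  | base =>
    intro q hq
    right
    have : (sL q).1 = 1 := congrArg Sigma.fst hq
    simpa using this
  | @sumL p h ih =>
    intro q hq
    rw [sL_inj hq]; exact Or.inl h
  | @skewL p h ih =>
    intro q hq
    have h1 : (sL q).1 = (kL p).1 := congrArg Sigma.fst hq
    have := inX_pos h
    simp at h1
    exact absurd hq (sL_ne_kL (by omega))
  | @sumR p h ih =>
    intro q hq
    have h1 : (sL q).1 = (sR p).1 := congrArg Sigma.fst hq
    have := inX_pos h
    simp at h1
    obtain ⟨r, rfl, rfl⟩ := sL_eq_sR hq (by omega)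
    exact inX0_sR (ih r rfl)
  | @skewR p h ih =>
    intro q hq
    have h1 : (sL q).1 = (kR p).1 := congrArg Sigma.fst hq
    have := inX_pos h
    simp at h1
    exact absurd hq (sL_ne_kR (by omega))

lemma inX0_of_sL {p : Pattern} (h : InX0 (sL p)) : InX0 p := by
  rcases h with h | h
  · exact inX0_of_sL_aux h _ rfl
  · simp at h

lemma inX0_of_sR {p : Pattern} (h : InX0 (sR p)) : InX0 p := by
  have := inX0_rc h
  rw [rc_sR] at this
  simpa using inX0_rc (inX0_of_sL this)

lemma inX0_of_kR {p : Pattern} (h : InX0 (kR p)) : InX0 p := by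
  have := inX0_compl h
  rw [compl_kR] at this
  simpa using inX0_compl (inX0_of_sR this)

lemma contains_size {p q : Pattern} (h : Contains p q) : p.1 ≤ q.1 := by
  obtain ⟨f, hf, -⟩ := h
  simpa using Fintype.card_le_of_injective f hf.injective

/-- Members of the class of size `n` containing `π`. -/
def T (π : Pattern) (n : ℕ) : Set Pattern := {p | InX0 p ∧ p.1 = n ∧ Contains π p}

noncomputable def c (π : Pattern) (n : ℕ) : ℕ := (T π n).ncard

lemma size_finite (n : ℕ) : {p : Pattern | p.1 = n}.Finite := by
  refine (Set.finite_range (fun σ : Equiv.Perm (Fin n) => (⟨n, σ⟩ : Pattern))).subset ?_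
  rintro ⟨m, σ⟩ h
  change m = n at h
  subst h
  exact ⟨σ, rfl⟩

lemma T_finite (π : Pattern) (n : ℕ) : (T π n).Finite :=
  (size_finite n).subset fun _ h => h.2.1

lemma half (u v : Pattern → Pattern) (hu : Function.Injective u) (hv : Function.Injective v)
    (huv : ∀ p, u (v p) = v (u p)) (hsu : ∀ p, (u p).1 = p.1 + 1) (hsv : ∀ p, (v p).1 = p.1 + 1)
    (he : ∀ p q, u q = v p → 0 < q.1 → ∃ r, q = v r ∧ p = u r)
    (hXv : ∀ p, InX0 (v p) → InX0 p) (hXu' : ∀ p, InX0 p → InX0 (u p))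
    (hXv' : ∀ p, InX0 p → InX0 (v p)) (π πL πR πLR : Pattern)
    (hL : ∀ q, Contains π (u q) ↔ Contains πL q) (hR : ∀ q, Contains π (v q) ↔ Contains πR q)
    (hLR : ∀ q, Contains πL (v q) ↔ Contains πLR q) (n : ℕ) :
    (u '' T πL (n + 1) ∪ v '' T πR (n + 1)).ncard + c πLR n = c πL (n + 1) + c πR (n + 1) := by
  have hi : u '' T πL (n + 1) ∩ v '' T πR (n + 1) = (u ∘ v) '' T πLR n := by
    ext x
    constructor
    · rintro ⟨⟨q, ⟨hq1, hq2, hq3⟩, rfl⟩, ⟨p, ⟨hp1, hp2, hp3⟩, hpq⟩⟩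
      obtain ⟨r, rfl, rfl⟩ := he p q hpq.symm (by omega)
      refine ⟨r, ⟨hXv _ hq1, ?_, (hLR r).1 hq3⟩, rfl⟩
      rw [hsv] at hq2; omega
    · rintro ⟨r, ⟨h1, h2, h3⟩, rfl⟩
      refine ⟨⟨v r, ⟨hXv' _ h1, by rw [hsv, h2], (hLR r).2 h3⟩, rfl⟩,
        ⟨u r, ⟨hXu' _ h1, by rw [hsu, h2], ?_⟩, (huv r).symm⟩⟩
      rw [← hR, ← huv, hL, hLR]; exact h3
  have h1 := Set.ncard_union_add_ncard_inter (u '' T πL (n + 1)) (v '' T πR (n + 1))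
    ((T_finite _ _).image _) ((T_finite _ _).image _)
  rw [hi, Set.ncard_image_of_injective _ hu, Set.ncard_image_of_injective _ hv,
    Set.ncard_image_of_injective _ (hu.comp hv)] at h1
  exact h1

lemma T_succ (π πL πR κL κR : Pattern)
    (hL : ∀ q, Contains π (sL q) ↔ Contains πL q) (hR : ∀ q, Contains π (sR q) ↔ Contains πR q)
    (kkL : ∀ q, Contains π (kL q) ↔ Contains κL q) (kkR : ∀ q, Contains π (kR q) ↔ Contains κR q)
    (n : ℕ) : T π (n + 2) = (sL '' T πL (n + 1) ∪ sR '' T πR (n + 1)) ∪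
      (kL '' T κL (n + 1) ∪ kR '' T κR (n + 1)) := by
  ext x
  constructor
  · rintro ⟨h1, h2, h3⟩
    rcases h1 with h1 | h1
    swap
    · omega
    cases h1 with
    | base => exact absurd h2 (by show 1 ≠ n + 2; omega)
    | @sumL p h =>
      change (sL p).1 = n + 2 at h2
      exact Or.inl (Or.inl ⟨p, ⟨Or.inl h, by simpa using h2, (hL p).1 h3⟩, rfl⟩)
    | @skewL p h =>
      change (kL p).1 = n + 2 at h2
      exact Or.inr (Or.inl ⟨p, ⟨Or.inl h, by simpa using h2, (kkL p).1 h3⟩, rfl⟩)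
    | @sumR p h =>
      change (sR p).1 = n + 2 at h2
      exact Or.inl (Or.inr ⟨p, ⟨Or.inl h, by simpa using h2, (hR p).1 h3⟩, rfl⟩)
    | @skewR p h =>
      change (kR p).1 = n + 2 at h2
      exact Or.inr (Or.inr ⟨p, ⟨Or.inl h, by simpa using h2, (kkR p).1 h3⟩, rfl⟩)
  · rintro ((⟨p, ⟨h1, h2, h3⟩, rfl⟩ | ⟨p, ⟨h1, h2, h3⟩, rfl⟩) |
      (⟨p, ⟨h1, h2, h3⟩, rfl⟩ | ⟨p, ⟨h1, h2, h3⟩, rfl⟩))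
    · exact ⟨inX0_sL h1, by simp [h2], (hL p).2 h3⟩
    · exact ⟨inX0_sR h1, by simp [h2], (hR p).2 h3⟩
    · exact ⟨inX0_kL h1, by simp [h2], (kkL p).2 h3⟩
    · exact ⟨inX0_kR h1, by simp [h2], (kkR p).2 h3⟩

lemma c_rec (π πL πR πLR κL κR κLR : Pattern)
    (hL : ∀ q, Contains π (sL q) ↔ Contains πL q) (hR : ∀ q, Contains π (sR q) ↔ Contains πR q)
    (hLR : ∀ q, Contains πL (sR q) ↔ Contains πLR q)
    (kkL : ∀ q, Contains π (kL q) ↔ Contains κL q) (kkR : ∀ q, Contains π (kR q) ↔ Contains κR q)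
    (kkLR : ∀ q, Contains κL (kR q) ↔ Contains κLR q) (n : ℕ) :
    c π (n + 2) + c πLR n + c κLR n =
      c πL (n + 1) + c πR (n + 1) + c κL (n + 1) + c κR (n + 1) := by
  have h1 := half sL sR sL_inj sR_inj sL_sR sL_fst sR_fst (fun p q => sL_eq_sR)
    (fun p => inX0_of_sR) (fun p => inX0_sL) (fun p => inX0_sR) π πL πR πLR hL hR hLR n
  have h2 := half kL kR kL_inj kR_inj kL_kR kL_fst kR_fst (fun p q => kL_eq_kR)
    (fun p => inX0_of_kR) (fun p => inX0_kL) (fun p => inX0_kR) π κL κR κLR kkL kkR kkLR n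
  have hd : Disjoint (sL '' T πL (n + 1) ∪ sR '' T πR (n + 1))
      (kL '' T κL (n + 1) ∪ kR '' T κR (n + 1)) := by
    rw [Set.disjoint_left]
    rintro x (⟨p, ⟨-, h2, -⟩, rfl⟩ | ⟨p, ⟨-, h2, -⟩, rfl⟩) (⟨q, -, hq⟩ | ⟨q, -, hq⟩)
    · exact sL_ne_kL (by omega) hq.symm
    · exact sL_ne_kR (by omega) hq.symm
    · exact sR_ne_kL (by omega) hq.symm
    · exact sR_ne_kR (by omega) hq.symm
  have h3 := Set.ncard_union_eq hd (((T_finite _ _).image _).union ((T_finite _ _).image _))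
    (((T_finite _ _).image _).union ((T_finite _ _).image _))
  rw [← T_succ π πL πR κL κR hL hR kkL kkR] at h3
  change c π (n + 2) = _ at h3
  omega

lemma c_zero {π : Pattern} {n : ℕ} (h : n < π.1) : c π n = 0 := by
  have : T π n = ∅ := by
    ext x
    simp only [Set.mem_empty_iff_false, iff_false]
    rintro ⟨-, h1, h2⟩
    have := contains_size h2
    omega
  rw [c, this, Set.ncard_empty]

lemma c_compl (π : Pattern) (n : ℕ) : c (compl π) n = c π n := by
  have : T (compl π) n = compl '' T π n := by
    ext x
    constructor
    · rintro ⟨h1, h2, h3⟩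
      refine ⟨compl x, ⟨inX0_compl h1, h2, ?_⟩, compl_compl x⟩
      rw [← contains_compl, compl_compl]; exact h3
    · rintro ⟨x, ⟨h1, h2, h3⟩, rfl⟩
      exact ⟨inX0_compl h1, h2, contains_compl.2 h3⟩
  rw [c, this, Set.ncard_image_of_injective _ compl_inj, c]

open PowerSeries in
/-- Generating function. -/
noncomputable def G (π : Pattern) : PowerSeries ℚ := PowerSeries.mk fun n => (c π n : ℚ)

lemma G_compl (π : Pattern) : G (compl π) = G π := by
  simp only [G, c_compl]

open PowerSeries in
lemma G_rec (π πL πR πLR : Pattern)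
    (hL : ∀ q, Contains π (sL q) ↔ Contains πL q) (hR : ∀ q, Contains π (sR q) ↔ Contains πR q)
    (hLR : ∀ q, Contains πL (sR q) ↔ Contains πLR q)
    (kkL : ∀ q, Contains π (kL q) ↔ Contains π q) (kkR : ∀ q, Contains π (kR q) ↔ Contains π q)
    (s1 : 1 < π.1) (s2 : 0 < πL.1) (s3 : 0 < πR.1) :
    G π + X * (X * G πLR) + X * (X * G π) = X * (G πL + G πR + G π + G π) := by
  ext n
  rcases n with _ | _ | n
  · simp only [map_add, coeff_zero_X_mul]
    simp [G, c_zero (show 0 < π.1 by omega)]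
  · simp only [map_add, coeff_succ_X_mul, coeff_zero_X_mul]
    simp [G, c_zero (show 0 < π.1 by omega), c_zero s1, c_zero s2, c_zero s3]
  · have := c_rec π πL πR πLR π π π hL hR hLR kkL kkR kkR n
    simp only [map_add, coeff_succ_X_mul, G, coeff_mk]
    exact_mod_cast this

open PowerSeries in
/-- Layer factors. -/
noncomputable def P : ℕ → ℕ → PowerSeries ℚ
  | 0, 0 => 1
  | 0, b + 1 => (1 - 3 * X + X ^ 2)⁻¹ * ((X - X ^ 2) * P 0 b)
  | a + 1, 0 => (1 - 3 * X + X ^ 2)⁻¹ * ((X - X ^ 2) * P a 0)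
  | a + 1, b + 1 => (1 - 2 * X + X ^ 2)⁻¹ * (X * P a (b + 1) + X * P (a + 1) b - X ^ 2 * P a b)
termination_by a b => a + b

/-- Layer over `ρ`. -/
def lay (a b : ℕ) (ρ : Pattern) : Pattern := sL^[a] (sR^[b] ρ)

lemma lay_succ_left (a b : ℕ) (ρ : Pattern) : lay (a + 1) b ρ = sL (lay a b ρ) :=
  Function.iterate_succ_apply' _ _ _

lemma lay_succ_right (a b : ℕ) (ρ : Pattern) : lay a (b + 1) ρ = sR (lay a b ρ) := by
  induction a with
  | zero => exact Function.iterate_succ_apply' _ _ _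
  | succ a ih => rw [lay_succ_left, ih, lay_succ_left, sL_sR]

lemma lay_size (a b : ℕ) (ρ : Pattern) : (lay a b ρ).1 = a + b + ρ.1 := by
  induction a with
  | zero =>
    induction b with
    | zero => simp [lay]
    | succ b ih => rw [lay_succ_right, sR_fst, ih]; omega
  | succ a ih => rw [lay_succ_left, sL_fst, ih]; omega

def Pos (ρ : Pattern) : Prop := ∃ q, 0 < q.1 ∧ (ρ = sL q ∨ ρ = sR q)
def Neg (ρ : Pattern) : Prop := ∃ q, 0 < q.1 ∧ (ρ = kL q ∨ ρ = kR q)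

lemma Neg.not_sL {ρ : Pattern} (h : Neg ρ) : ¬ ∃ r, ρ = sL r := by
  rintro ⟨r, rfl⟩
  obtain ⟨q, hq, h | h⟩ := h
  · have := congrArg Sigma.fst h
    simp only [sL_fst, kL_fst] at this
    exact sL_ne_kL (by omega) h
  · have := congrArg Sigma.fst h
    simp only [sL_fst, kR_fst] at this
    exact sL_ne_kR (by omega) h

lemma Neg.not_sR {ρ : Pattern} (h : Neg ρ) : ¬ ∃ r, ρ = sR r := by
  rintro ⟨r, rfl⟩
  obtain ⟨q, hq, h | h⟩ := h
  · have := congrArg Sigma.fst h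
    simp only [sR_fst, kL_fst] at this
    exact sR_ne_kL (by omega) h
  · have := congrArg Sigma.fst h
    simp only [sR_fst, kR_fst] at this
    exact sR_ne_kR (by omega) h

lemma Neg.size {ρ : Pattern} (h : Neg ρ) : 2 ≤ ρ.1 := by
  obtain ⟨q, hq, rfl | rfl⟩ := h
  · simp; omega
  · simp; omega

lemma Pos.not_kL {ρ : Pattern} (h : Pos ρ) : ¬ ∃ r, ρ = kL r := by
  rintro ⟨r, rfl⟩
  obtain ⟨q, hq, h | h⟩ := h
  · exact sL_ne_kL hq h.symm
  · exact sR_ne_kL hq h.symm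

lemma Pos.not_kR {ρ : Pattern} (h : Pos ρ) : ¬ ∃ r, ρ = kR r := by
  rintro ⟨r, rfl⟩
  obtain ⟨q, hq, h | h⟩ := h
  · exact sL_ne_kR hq h.symm
  · exact sR_ne_kR hq h.symm

lemma lay_not_sL {ρ : Pattern} (h : Neg ρ) (b : ℕ) : ¬ ∃ r, lay 0 b ρ = sL r := by
  induction b with
  | zero => exact h.not_sL
  | succ b ih =>
    rintro ⟨r, hr⟩
    rw [lay_succ_right] at hr
    have hs := congrArg Sigma.fst hr
    have := h.size
    simp only [sR_fst, sL_fst, lay_size] at hs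
    obtain ⟨r', -, h2⟩ := sL_eq_sR hr.symm (by omega)
    exact ih ⟨r', h2⟩

lemma lay_not_sR {ρ : Pattern} (h : Neg ρ) (a : ℕ) : ¬ ∃ r, lay a 0 ρ = sR r := by
  induction a with
  | zero => exact h.not_sR
  | succ b ih =>
    rintro ⟨r, hr⟩
    rw [lay_succ_left] at hr
    have := h.size
    obtain ⟨r', h1, -⟩ := sL_eq_sR hr (by rw [lay_size]; omega)
    exact ih ⟨r', h1⟩

lemma lay_pos {ρ : Pattern} (h : 0 < ρ.1) {a b : ℕ} (hab : a ≠ 0 ∨ b ≠ 0) : Pos (lay a b ρ) := by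
  rcases hab with hab | hab
  · obtain ⟨a, rfl⟩ := Nat.exists_eq_succ_of_ne_zero hab
    exact ⟨lay a b ρ, by rw [lay_size]; omega, Or.inl (lay_succ_left _ _ _)⟩
  · obtain ⟨b, rfl⟩ := Nat.exists_eq_succ_of_ne_zero hab
    exact ⟨lay a b ρ, by rw [lay_size]; omega, Or.inr (lay_succ_right _ _ _)⟩

open PowerSeries in
lemma inv_solve {D A B : PowerSeries ℚ} (hD : constantCoeff D ≠ 0) (h : D * A = B) :
    A = D⁻¹ * B := by
  rw [← h, ← mul_assoc, PowerSeries.inv_mul_cancel _ hD, one_mul]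

open PowerSeries in
lemma G_lay {ρ : Pattern} (h : Neg ρ) : ∀ s a b : ℕ, a + b ≤ s → G (lay a b ρ) = P a b * G ρ := by
  have hs := h.size
  intro s
  induction s with
  | zero =>
    intro a b hab
    obtain rfl : a = 0 := by omega
    obtain rfl : b = 0 := by omega
    rw [P, one_mul]; rfl
  | succ s ih =>
    intro a b hab
    by_cases h0 : a + b ≤ s
    · exact ih a b h0
    have hpos : Pos (lay a b ρ) := lay_pos (by omega) (by omega)
    have kkL : ∀ q, Contains (lay a b ρ) (kL q) ↔ Contains (lay a b ρ) q := fun q =>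
      contains_kL_iff hpos.not_kL
    have kkR : ∀ q, Contains (lay a b ρ) (kR q) ↔ Contains (lay a b ρ) q := fun q =>
      contains_kR_iff hpos.not_kR
    rcases a with _ | a <;> rcases b with _ | b
    · omega
    · have e := G_rec (lay 0 (b + 1) ρ) (lay 0 (b + 1) ρ) (lay 0 b ρ) (lay 0 b ρ)
        (fun q => contains_sL_iff (lay_not_sL h _))
        (fun q => by rw [lay_succ_right]; exact contains_sR_sR)
        (fun q => by rw [lay_succ_right]; exact contains_sR_sR) kkL kkR
        (by rw [lay_size]; omega) (by rw [lay_size]; omega) (by rw [lay_size]; omega)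
      rw [ih 0 b (by omega)] at e
      rw [P, mul_assoc]
      refine inv_solve (by simp) ?_
      linear_combination e
    · have e := G_rec (lay (a + 1) 0 ρ) (lay a 0 ρ) (lay (a + 1) 0 ρ) (lay a 0 ρ)
        (fun q => by rw [lay_succ_left]; exact contains_sL_sL)
        (fun q => contains_sR_iff (lay_not_sR h _))
        (fun q => contains_sR_iff (lay_not_sR h _)) kkL kkR
        (by rw [lay_size]; omega) (by rw [lay_size]; omega) (by rw [lay_size]; omega)
      rw [ih a 0 (by omega)] at e
      rw [P, mul_assoc]
      refine inv_solve (by simp) ?_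
      linear_combination e
    · have e := G_rec (lay (a + 1) (b + 1) ρ) (lay a (b + 1) ρ) (lay (a + 1) b ρ) (lay a b ρ)
        (fun q => by rw [lay_succ_left]; exact contains_sL_sL)
        (fun q => by rw [lay_succ_right]; exact contains_sR_sR)
        (fun q => by rw [lay_succ_right]; exact contains_sR_sR) kkL kkR
        (by rw [lay_size]; omega) (by rw [lay_size]; omega) (by rw [lay_size]; omega)
      rw [ih a (b + 1) (by omega), ih (a + 1) b (by omega),
        ih a b (by omega)] at e
      rw [P, mul_assoc]
      refine inv_solve (by simp) ?_
      linear_combination e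


def StrP (π : Pattern) : Prop := (∃ k, π = sL^[k] onePat) ∨
  ∃ ρ a b, InX ρ ∧ Neg ρ ∧ (a ≠ 0 ∨ b ≠ 0) ∧ π = lay a b ρ

def Str (π : Pattern) : Prop := StrP π ∨ StrP (compl π)

lemma neg_of_pos_compl {π : Pattern} (h : Pos (compl π)) : Neg π := by
  obtain ⟨q, hq, h | h⟩ := h
  · exact ⟨compl q, hq, Or.inl (by rw [← compl_sL, ← h, compl_compl])⟩
  · exact ⟨compl q, hq, Or.inr (by rw [← compl_sR, ← h, compl_compl])⟩

lemma iter_size (k : ℕ) : (sL^[k] onePat).1 = k + 1 := by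
  induction k with
  | zero => rfl
  | succ k ih => rw [Function.iterate_succ_apply', sL_fst, ih]

lemma iter_inX (k : ℕ) : InX (sL^[k] onePat) := by
  induction k with
  | zero => exact InX.base
  | succ k ih => rw [Function.iterate_succ_apply']; exact InX.sumL ih

lemma Str.cases {π : Pattern} (h : Str π) : StrP π ∨ Neg π := by
  rcases h with h | h
  · exact Or.inl h
  · rcases h with ⟨k, hk⟩ | ⟨ρ, a, b, h1, h2, h3, h4⟩
    · rcases k with _ | k
      · left; left
        refine ⟨0, eq_of_size_one ?_ rfl⟩
        exact congrArg Sigma.fst hk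
      · right
        apply neg_of_pos_compl
        refine ⟨sL^[k] onePat, by rw [iter_size]; omega, Or.inl ?_⟩
        rw [hk, Function.iterate_succ_apply']
    · right
      apply neg_of_pos_compl
      rw [h4]
      exact lay_pos (by have := h2.size; omega) h3

lemma Str.step_sL {π : Pattern} (h : Str π) (hX : InX π) : StrP (sL π) := by
  rcases h.cases with (⟨k, rfl⟩ | ⟨ρ, a, b, h1, h2, h3, rfl⟩) | h
  · exact Or.inl ⟨k + 1, (Function.iterate_succ_apply' _ _ _).symm⟩
  · exact Or.inr ⟨ρ, a + 1, b, h1, h2, by omega, (lay_succ_left _ _ _).symm⟩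
  · exact Or.inr ⟨π, 1, 0, hX, h, by omega, rfl⟩

lemma Str.step_sR {π : Pattern} (h : Str π) (hX : InX π) : StrP (sR π) := by
  rcases h.cases with (⟨k, rfl⟩ | ⟨ρ, a, b, h1, h2, h3, rfl⟩) | h
  · refine Or.inl ⟨k + 1, ?_⟩
    exact (lay_succ_right k 0 onePat).symm
  · exact Or.inr ⟨ρ, a, b + 1, h1, h2, by omega, (lay_succ_right _ _ _).symm⟩
  · exact Or.inr ⟨π, 0, 1, hX, h, by omega, rfl⟩

lemma Str.compl {π : Pattern} (h : Str π) : Str (compl π) := by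
  unfold Str at *
  rw [compl_compl]
  exact h.symm

lemma inX_str {π : Pattern} (h : InX π) : Str π := by
  induction h with
  | base => exact Or.inl (Or.inl ⟨0, rfl⟩)
  | sumL h ih => exact Or.inl (ih.step_sL h)
  | sumR h ih => exact Or.inl (ih.step_sR h)
  | @skewL p h ih =>
    right
    change StrP (XC.compl (kL p))
    rw [compl_kL]
    exact ih.compl.step_sL (inX_compl h)
  | @skewR p h ih =>
    right
    change StrP (XC.compl (kR p))
    rw [compl_kR]
    exact ih.compl.step_sR (inX_compl h)

lemma repr_aux : ∀ n : ℕ, ∀ π, InX π → π.1 ≤ n → ∃ k, k ≤ n ∧ ∃ M : Multiset (ℕ × ℕ),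
    (∀ s ∈ M, 0 < s.1 + s.2) ∧ (M.map fun s => s.1 + s.2).sum ≤ n ∧
    G π = (M.map fun s => P s.1 s.2).prod * G (sL^[k] onePat) := by
  intro n
  induction n using Nat.strong_induction_on with
  | _ n ih =>
  have key : ∀ q, StrP q → q.1 ≤ n → ∃ k, k ≤ n ∧ ∃ M : Multiset (ℕ × ℕ),
      (∀ s ∈ M, 0 < s.1 + s.2) ∧ (M.map fun s => s.1 + s.2).sum ≤ n ∧
      G q = (M.map fun s => P s.1 s.2).prod * G (sL^[k] onePat) := by
    rintro q (⟨k, rfl⟩ | ⟨ρ, a, b, h1, h2, h3, rfl⟩) hq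
    · rw [iter_size] at hq
      exact ⟨k, by omega, 0, by simp, by simp, by simp⟩
    · rw [lay_size] at hq
      obtain ⟨k, hk, M, hM1, hM2, hM3⟩ := ih (n - (a + b)) (by omega) ρ h1 (by omega)
      refine ⟨k, by omega, (a, b) ::ₘ M, ?_, ?_, ?_⟩
      · intro s hs
        rcases Multiset.mem_cons.1 hs with rfl | hs
        · show 0 < a + b
          omega
        · exact hM1 s hs
      · rw [Multiset.map_cons, Multiset.sum_cons]
        show a + b + _ ≤ n
        omega
      · rw [Multiset.map_cons, Multiset.prod_cons, G_lay h2 _ a b le_rfl, hM3, mul_assoc]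
  intro π hX hn
  rcases inX_str hX with h | h
  · exact key π h hn
  · rw [← G_compl]
    exact key _ h hn

/-- Possible layers. -/
def S (n : ℕ) : Finset (ℕ × ℕ) :=
  (Finset.range (n + 1) ×ˢ Finset.range (n + 1)).filter fun s => 0 < s.1 + s.2

/-- Multiplicity codes. -/
noncomputable def codes (n : ℕ) : Finset (↥(S n) → ℕ) :=
  (Fintype.piFinset fun _ => Finset.range (n + 1)).filter fun m =>
    ∑ s, m s * (s.1.1 + s.1.2) ≤ n

lemma repr_code {n : ℕ} {π : Pattern} (hX : InX π) (hn : π.1 = n) :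
    ∃ k : Fin (n + 1), ∃ m : ↥(codes n),
    G π = (∏ s, P s.1.1 s.1.2 ^ m.1 s) * G (sL^[(k : ℕ)] onePat) := by
  obtain ⟨k, hk, M, h1, h2, h3⟩ := repr_aux n π hX hn.le
  have hsub : M.toFinset ⊆ S n := by
    intro s hs
    rw [Multiset.mem_toFinset] at hs
    have := Multiset.single_le_sum (s := M.map fun s => s.1 + s.2) (by simp) (s.1 + s.2)
      (Multiset.mem_map_of_mem (fun s : ℕ × ℕ => s.1 + s.2) hs)
    have := h1 s hs
    simp only [S, Finset.mem_filter, Finset.mem_product, Finset.mem_range]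
    omega
  have hsum : ∑ s : ↥(S n), M.count s.1 * (s.1.1 + s.1.2) ≤ n := by
    rw [Finset.sum_coe_sort (S n) (fun s => M.count s * (s.1 + s.2))]
    rw [← Finset.sum_subset hsub]
    · rw [Finset.sum_multiset_map_count] at h2
      simpa using h2
    · intro s _ hs
      rw [Multiset.mem_toFinset] at hs
      rw [Multiset.count_eq_zero_of_notMem hs, zero_mul]
  refine ⟨⟨k, by omega⟩, ⟨fun s => M.count s.1, ?_⟩, ?_⟩
  · simp only [codes, Finset.mem_filter, Fintype.mem_piFinset, Finset.mem_range]
    refine ⟨fun s => ?_, hsum⟩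
    have h4 := Finset.single_le_sum (f := fun s : ↥(S n) => M.count s.1 * (s.1.1 + s.1.2))
      (fun _ _ => Nat.zero_le _) (Finset.mem_univ s)
    have h5 : 0 < s.1.1 + s.1.2 := (Finset.mem_filter.1 s.2).2
    have h6 : M.count s.1 * 1 ≤ M.count s.1 * (s.1.1 + s.1.2) := Nat.mul_le_mul_left _ h5
    omega
  · rw [h3]
    congr 1
    rw [Finset.prod_coe_sort (S n) (fun s => P s.1 s.2 ^ M.count s),
      ← Finset.prod_subset hsub, Finset.prod_multiset_map_count]
    intro s _ hs
    rw [Multiset.mem_toFinset] at hs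
    rw [Multiset.count_eq_zero_of_notMem hs, pow_zero]

lemma card_eq (Q : Pattern → Prop) (n : ℕ) :
    Nat.card {σ : Equiv.Perm (Fin n) // Q ⟨n, σ⟩} = {p : Pattern | p.1 = n ∧ Q p}.ncard := by
  have hinj : Function.Injective (fun σ : Equiv.Perm (Fin n) => (⟨n, σ⟩ : Pattern)) := by
    intro σ τ h
    exact eq_of_heq (Sigma.mk.inj h).2
  have : {p : Pattern | p.1 = n ∧ Q p} =
      (fun σ : Equiv.Perm (Fin n) => (⟨n, σ⟩ : Pattern)) '' {σ | Q ⟨n, σ⟩} := by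
    ext ⟨m, τ⟩
    constructor
    · rintro ⟨h, hQ⟩
      change m = n at h
      subst h
      exact ⟨τ, hQ, rfl⟩
    · rintro ⟨σ, hσ, h⟩
      rw [← h]
      exact ⟨rfl, hσ⟩
  rw [this, Set.ncard_image_of_injective _ hinj]
  rfl

lemma c_add_av (π : Pattern) {n : ℕ} (hn : n ≠ 0) :
    c π n + avXCount π n = {p : Pattern | p.1 = n ∧ InX p}.ncard := by
  have e1 : avXCount π n = {p : Pattern | p.1 = n ∧ (InX p ∧ ¬ Contains π p)}.ncard :=
    card_eq (fun p => InX p ∧ ¬ Contains π p) n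
  have e2 : {p : Pattern | p.1 = n ∧ InX p} =
      T π n ∪ {p : Pattern | p.1 = n ∧ (InX p ∧ ¬ Contains π p)} := by
    ext p
    simp only [T, InX0, Set.mem_union, Set.mem_setOf_eq]
    by_cases h : p.1 = n
    · have h0 : p.1 ≠ 0 := by omega
      tauto
    · tauto
  have hd : Disjoint (T π n) {p : Pattern | p.1 = n ∧ (InX p ∧ ¬ Contains π p)} := by
    rw [Set.disjoint_left]
    rintro p ⟨-, -, h⟩ ⟨-, -, h'⟩
    exact h' h
  rw [e1, e2, Set.ncard_union_eq hd (T_finite _ _) ((size_finite n).subset fun _ h => h.1), c]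

lemma wilf_of_G {p q : Pattern} (h : G p = G q) : WilfEquivX p q := by
  intro n
  have hc : c p n = c q n := by
    have := congrArg (PowerSeries.coeff n) h
    simp only [G, PowerSeries.coeff_mk] at this
    exact_mod_cast this
  rcases Nat.eq_zero_or_pos n with rfl | hn
  · have : ∀ r, avXCount r 0 = 0 := by
      intro r
      unfold avXCount
      rw [Nat.card_eq_zero]
      left
      constructor
      rintro ⟨σ, h, -⟩
      exact absurd (inX_pos h) (lt_irrefl 0)
    rw [this, this]
  · have h1 := c_add_av p hn.ne'
    have h2 := c_add_av q hn.ne'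
    omega

lemma wcount_le (n : ℕ) : wcount n ≤ (n + 1) * (codes n).card := by
  have H : ∀ σ : {σ : Equiv.Perm (Fin n) // InX ⟨n, σ⟩}, ∃ km : Fin (n + 1) × ↥(codes n),
      G ⟨n, σ.1⟩ = (∏ s, P s.1.1 s.1.2 ^ km.2.1 s) * G (sL^[(km.1 : ℕ)] onePat) := by
    intro σ
    obtain ⟨k, m, h⟩ := repr_code σ.2 rfl
    exact ⟨(k, m), h⟩
  choose F hF using H
  have : Function.Injective (fun x : Quot (fun σ σ' : {σ : Equiv.Perm (Fin n) // InX ⟨n, σ⟩} =>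
      WilfEquivX ⟨n, σ.1⟩ ⟨n, σ'.1⟩) => F (Quot.out x)) := by
    intro x y hxy
    rw [← Quot.out_eq x, ← Quot.out_eq y]
    apply Quot.sound
    apply wilf_of_G
    simp only at hxy
    rw [hF, hF, hxy]
  have h2 := Nat.card_le_card_of_injective _ this
  unfold wcount
  refine h2.trans (le_of_eq ?_)
  simp

lemma wcount_pos {n : ℕ} (hn : n ≠ 0) : 1 ≤ wcount n := by
  obtain ⟨k, rfl⟩ := Nat.exists_eq_succ_of_ne_zero hn
  have hx := iter_inX k
  have hs := iter_size k
  generalize sL^[k] onePat = p at hx hs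
  obtain ⟨m, σ⟩ := p
  change m = k + 1 at hs
  subst hs
  unfold wcount
  have : Nonempty (Quot (fun σ σ' : {σ : Equiv.Perm (Fin (k + 1)) // InX ⟨k + 1, σ⟩} =>
      WilfEquivX ⟨k + 1, σ.1⟩ ⟨k + 1, σ'.1⟩)) := ⟨Quot.mk _ ⟨σ, hx⟩⟩
  exact Nat.card_pos

lemma geom_le {x : ℝ} (h0 : 0 ≤ x) (h1 : x < 1) (n : ℕ) :
    ∑ j ∈ Finset.range n, x ^ j ≤ (1 - x)⁻¹ := by
  rw [← tsum_geometric_of_lt_one h0 h1]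
  exact (summable_geometric_of_lt_one h0 h1).sum_le_tsum _ (fun i _ => by positivity)

lemma codes_bound {x : ℝ} (h0 : 0 < x) (h1 : x < 1) (n : ℕ) :
    ((codes n).card : ℝ) * x ^ n ≤ Real.exp ((1 - x)⁻¹ * ((1 - x)⁻¹ * (1 - x)⁻¹)) := by
  have hx : 0 < 1 - x := by linarith
  calc ((codes n).card : ℝ) * x ^ n = ∑ m ∈ codes n, x ^ n := by simp
    _ ≤ ∑ m ∈ codes n, ∏ s, (x ^ (s.1.1 + s.1.2)) ^ m s := by
        apply Finset.sum_le_sum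
        intro m hm
        have := (Finset.mem_filter.1 hm).2
        simp_rw [← pow_mul]
        rw [Finset.prod_pow_eq_pow_sum]
        apply pow_le_pow_of_le_one h0.le h1.le
        simpa [Nat.mul_comm] using this
    _ ≤ ∑ m ∈ Fintype.piFinset (fun _ : ↥(S n) => Finset.range (n + 1)),
          ∏ s, (x ^ (s.1.1 + s.1.2)) ^ m s := by
        apply Finset.sum_le_sum_of_subset_of_nonneg (Finset.filter_subset _ _)
        intro m _ _
        positivity
    _ = ∏ s : ↥(S n), ∑ j ∈ Finset.range (n + 1), (x ^ (s.1.1 + s.1.2)) ^ j := by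
        rw [Finset.prod_univ_sum]
    _ ≤ ∏ s : ↥(S n), Real.exp ((1 - x)⁻¹ * x ^ (s.1.1 + s.1.2)) := by
        apply Finset.prod_le_prod
        · intro s _; positivity
        · intro s _
          have h5 : s.1.1 + s.1.2 ≠ 0 := (Finset.mem_filter.1 s.2).2.ne'
          generalize s.1.1 + s.1.2 = w at h5
          have hy0 : 0 < x ^ w := by positivity
          have hy1 : x ^ w ≤ x := pow_le_of_le_one h0.le h1.le h5
          generalize x ^ w = y at hy0 hy1
          refine (geom_le hy0.le (by linarith) _).trans ?_
          have e : (1 - y)⁻¹ = 1 + (1 - y)⁻¹ * y := by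
            have : 1 - y ≠ 0 := by linarith
            field_simp
            ring
          rw [e]
          have : (1 - y)⁻¹ * y ≤ (1 - x)⁻¹ * y := by gcongr
          have := Real.add_one_le_exp ((1 - x)⁻¹ * y)
          linarith
    _ = Real.exp ((1 - x)⁻¹ * ∑ s ∈ S n, x ^ (s.1 + s.2)) := by
        rw [← Real.exp_sum, ← Finset.mul_sum, Finset.sum_coe_sort (S n) (fun s => x ^ (s.1 + s.2))]
    _ ≤ _ := by
        apply Real.exp_le_exp.2
        gcongr
        calc ∑ s ∈ S n, x ^ (s.1 + s.2)
            ≤ ∑ s ∈ Finset.range (n + 1) ×ˢ Finset.range (n + 1), x ^ (s.1 + s.2) := by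
              apply Finset.sum_le_sum_of_subset_of_nonneg (Finset.filter_subset _ _)
              intro m _ _
              positivity
          _ = (∑ a ∈ Finset.range (n + 1), x ^ a) * ∑ b ∈ Finset.range (n + 1), x ^ b := by
              rw [Finset.sum_mul_sum, Finset.sum_product]
              simp_rw [pow_add]
          _ ≤ _ := by
              have := geom_le h0.le h1 (n + 1)
              gcongr

lemma wcount_littleO {b : ℝ} (hb : 1 < b) :
    (fun n : ℕ => (wcount n : ℝ)) =o[Filter.atTop] (fun n : ℕ => b ^ n) := by
  obtain ⟨d, hd1, hdb⟩ := exists_between hb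
  have hd0 : 0 < d := by linarith
  set K := Real.exp ((1 - d⁻¹)⁻¹ * ((1 - d⁻¹)⁻¹ * (1 - d⁻¹)⁻¹)) with hK
  have hle : ∀ n : ℕ, (wcount n : ℝ) ≤ K * ((n : ℝ) ^ 1 * d ^ n + (n : ℝ) ^ 0 * d ^ n) := by
    intro n
    have h1 := codes_bound (inv_pos.2 hd0) (inv_lt_one_of_one_lt₀ hd1) n
    rw [← hK, inv_pow, ← div_eq_mul_inv, div_le_iff₀ (by positivity)] at h1
    have h2 : (wcount n : ℝ) ≤ (n + 1) * (codes n).card := by exact_mod_cast wcount_le n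
    calc (wcount n : ℝ) ≤ (n + 1) * (codes n).card := h2
      _ ≤ (n + 1) * (K * d ^ n) := by gcongr
      _ = _ := by ring
  have hlt : ‖d‖ < b := by rwa [Real.norm_of_nonneg hd0.le]
  have ho := ((isLittleO_pow_const_mul_const_pow_const_pow_of_norm_lt 1 hlt).add
    (isLittleO_pow_const_mul_const_pow_const_pow_of_norm_lt 0 hlt)).const_mul_left K
  refine Asymptotics.IsBigO.trans_isLittleO ?_ ho
  refine Asymptotics.IsBigO.of_bound 1 (Filter.Eventually.of_forall fun n => ?_)
  rw [one_mul, Real.norm_of_nonneg (Nat.cast_nonneg _)]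
  exact (hle n).trans (le_abs_self _)

def emptyPat : Pattern := ⟨0, 1⟩

lemma contains_empty (q : Pattern) : Contains emptyPat q :=
  ⟨fun i => Fin.elim0 i, fun i => Fin.elim0 i, fun i => Fin.elim0 i⟩

lemma xcount_eq (n : ℕ) : xcount n = c emptyPat n := by
  have := card_eq InX0 n
  unfold xcount
  rw [this, c]
  congr 1
  ext p
  simp only [T, Set.mem_setOf_eq, contains_empty, and_true]
  tauto

lemma xcount_rec (n : ℕ) : xcount (n + 2) + 2 * xcount n = 4 * xcount (n + 1) := by
  have h : ∀ u : Pattern → Pattern, ∀ q, Contains emptyPat (u q) ↔ Contains emptyPat q :=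
    fun u q => by simp [contains_empty]
  have := c_rec emptyPat emptyPat emptyPat emptyPat emptyPat emptyPat emptyPat
    (h _) (h _) (h _) (h _) (h _) (h _) n
  simp only [xcount_eq]
  omega

lemma xcount_zero : xcount 0 = 1 := by
  rw [xcount_eq, c, Set.ncard_eq_one]
  refine ⟨emptyPat, ?_⟩
  ext p
  simp only [T, Set.mem_setOf_eq, contains_empty, and_true, Set.mem_singleton_iff]
  constructor
  · rintro ⟨-, h⟩; exact eq_of_size_zero h rfl
  · rintro rfl; exact ⟨Or.inr rfl, rfl⟩

lemma xcount_one : xcount 1 = 1 := by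
  rw [xcount_eq, c, Set.ncard_eq_one]
  refine ⟨onePat, ?_⟩
  ext p
  simp only [T, Set.mem_setOf_eq, contains_empty, and_true, Set.mem_singleton_iff]
  constructor
  · rintro ⟨-, h⟩; exact eq_of_size_one h rfl
  · rintro rfl; exact ⟨Or.inl InX.base, rfl⟩

lemma xcount_formula (n : ℕ) :
    (xcount n : ℝ) = (2 - √2) / 4 * (2 + √2) ^ n + (2 + √2) / 4 * (2 - √2) ^ n ∧
    (xcount (n + 1) : ℝ) =
      (2 - √2) / 4 * (2 + √2) ^ (n + 1) + (2 + √2) / 4 * (2 - √2) ^ (n + 1) := by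
  have h2 : √2 ^ 2 = 2 := Real.sq_sqrt (by norm_num)
  induction n with
  | zero =>
    rw [xcount_zero, xcount_one]
    constructor
    · push_cast; ring
    · push_cast; linear_combination (1 / 2) * h2
  | succ n ih =>
    refine ⟨ih.2, ?_⟩
    have hr : (xcount (n + 2) : ℝ) + 2 * xcount n = 4 * xcount (n + 1) := by
      exact_mod_cast xcount_rec n
    rw [ih.1, ih.2] at hr
    show (xcount (n + 2) : ℝ) = _
    have hs : (2 + √2) ^ 2 = 4 * (2 + √2) - 2 := by linear_combination h2
    have ht : (2 - √2) ^ 2 = 4 * (2 - √2) - 2 := by linear_combination h2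
    generalize 2 + √2 = s at *
    generalize 2 - √2 = t at *
    have e1 : s ^ (n + 1 + 1) = s ^ n * s ^ 2 := by ring
    have e2 : t ^ (n + 1 + 1) = t ^ n * t ^ 2 := by ring
    rw [e1, e2, hs, ht]
    linear_combination hr

lemma xcount_ge (n : ℕ) : (2 - √2) / 4 * (2 + √2) ^ n ≤ (xcount n : ℝ) := by
  rw [(xcount_formula n).1]
  have : √2 ≤ 2 := by rw [Real.sqrt_le_left (by norm_num)]; norm_num
  have h3 : 0 ≤ 2 - √2 := by linarith
  have : 0 ≤ (2 + √2) / 4 * (2 - √2) ^ n := by positivity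
  linarith

lemma part_one :
    Filter.Tendsto (fun n : ℕ => (wcount n : ℝ) ^ ((n : ℝ)⁻¹)) Filter.atTop (nhds 1) := by
  rw [tendsto_order]
  constructor
  · intro a ha
    filter_upwards [Filter.eventually_ne_atTop 0] with n hn
    refine ha.trans_le (Real.one_le_rpow ?_ (by positivity))
    exact_mod_cast wcount_pos hn
  · intro b hb
    obtain ⟨d, hd1, hdb⟩ := exists_between hb
    have := (wcount_littleO hd1).bound (show (0 : ℝ) < 1 by norm_num)
    filter_upwards [this, Filter.eventually_ne_atTop 0] with n hn hn0
    have hd0 : 0 < d := by linarith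
    rw [one_mul, Real.norm_of_nonneg (by positivity), Real.norm_of_nonneg (by positivity)] at hn
    refine lt_of_le_of_lt ?_ hdb
    calc (wcount n : ℝ) ^ ((n : ℝ)⁻¹) ≤ (d ^ n) ^ ((n : ℝ)⁻¹) :=
          Real.rpow_le_rpow (by positivity) hn (by positivity)
      _ = d := Real.pow_rpow_inv_natCast hd0.le hn0

lemma part_two (r : ℝ) (hr : 1 / (2 + √2) < r) :
    (fun n : ℕ => (wcount n : ℝ)) =o[Filter.atTop] (fun n : ℕ => r ^ n * (xcount n : ℝ)) := by
  have hs : 0 < 2 + √2 := by positivity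
  have hb : 1 < r * (2 + √2) := by rwa [div_lt_iff₀ hs] at hr
  have hr0 : 0 < r := lt_trans (by positivity) hr
  have h2 : √2 < 2 := by rw [Real.sqrt_lt' (by norm_num)]; norm_num
  have hA : 0 < (2 - √2) / 4 := by linarith
  refine (wcount_littleO hb).trans_isBigO ?_
  refine Asymptotics.IsBigO.of_bound ((2 - √2) / 4)⁻¹ (Filter.Eventually.of_forall fun n => ?_)
  rw [Real.norm_of_nonneg (by positivity), Real.norm_of_nonneg (by positivity),
    inv_mul_eq_div, le_div_iff₀ hA, mul_pow]
  have := xcount_ge n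
  calc r ^ n * (2 + √2) ^ n * ((2 - √2) / 4) = r ^ n * ((2 - √2) / 4 * (2 + √2) ^ n) := by ring
    _ ≤ _ := by gcongr

end XC


/-- w_n^{1/n} → 1, and for every r with 1/(2+√2) < r < 1 we have
w_n = o(r^n · |X_n|): an exponential Wilf-collapse. -/
theorem wilf_collapse_in_X :
    Filter.Tendsto (fun n : ℕ => (wcount n : ℝ) ^ ((n : ℝ)⁻¹)) Filter.atTop (nhds 1) ∧
      ∀ r : ℝ, 1 / (2 + Real.sqrt 2) < r → r < 1 →
        (fun n : ℕ => (wcount n : ℝ)) =o[Filter.atTop]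
          (fun n : ℕ => r ^ n * (xcount n : ℝ)) := by
  exact ⟨XC.part_one, fun r h1 _ => XC.part_two r h1⟩
end
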